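/- arXiv:1703.10268 — 4 statements merged into one kernel-verified Lean document; each statement's English description precedes it below -/
import Mathlib

section
/- Let n, d be integers with 1 ≤ d ≤ ⌊(n-1)/2⌋, and set h(n,d) = binomial(n-d, 2) + d². If G is a nonhamiltonian graph on n vertices with minimum degree δ(G) ≥ d, then e(G) ≤ max{h(n,d), h(n, ⌊(n-1)/2⌋)}. -/
/-- `h(n,d) = C(n-d,2) + d²` from Erdős's theorem. -/
def erdosH (n d : ℕ) : ℕ := (n - d).choose 2 + d ^ 2

namespace SimpleGraph

section Hamiltonian

variable {V : Type*} [Fintype V] [DecidableEq V] {G : SimpleGraph V} {u v : V}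

/-- A Hamiltonian path with adjacent endpoints closes up to a Hamiltonian cycle. -/
theorem Walk.IsHamiltonian.isHamiltonian_of_adj {p : G.Walk u v} (hp : p.IsHamiltonian)
    (hV : 3 ≤ Fintype.card V) (h : G.Adj v u) : G.IsHamiltonian := by
  refine fun _ ↦ ⟨v, .cons h p, ?_⟩
  have hlen := hp.length_eq
  refine Walk.isHamiltonianCycle_iff_isCycle_and_length_eq.2
    ⟨(Walk.cons_isCycle_iff _ _).2 ⟨hp.isPath, fun he ↦ ?_⟩, ?_⟩
  · have := hp.isPath.length_eq_one_of_mem_edges (Sym2.eq_swap ▸ he)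
    omega
  · rw [Walk.length_cons]
    omega

/-- A Hamiltonian path `v = x₀, …, xₗ = u` with crossing chords `u xᵢ` and `xᵢ₊₁ v` can be
rerouted into a Hamiltonian cycle. -/
theorem Walk.IsHamiltonian.isHamiltonian_of_crossing {p : G.Walk v u} (hp : p.IsHamiltonian)
    (hV : 3 ≤ Fintype.card V) {i : ℕ} (hi : i < p.length) (hu : G.Adj u (p.getVert i))
    (hv : G.Adj v (p.getVert (i + 1))) : G.IsHamiltonian := by
  let q := (p.take i).append (.cons hu.symm (p.drop (i + 1)).reverse)
  have hperm : q.support.Perm p.support := by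
    have hs : q.support = p.support.take (i + 1) ++ (p.support.drop (i + 1)).reverse := by
      simp [q, Walk.support_append, Walk.support_take, Walk.drop_support_eq_support_drop_min,
        Nat.min_eq_left (Nat.succ_le_of_lt hi)]
    rw [hs]
    refine ((List.reverse_perm _).append_left _).trans ?_
    rw [List.take_append_drop]
  have hq : q.IsHamiltonian := fun a ↦ by rw [hperm.count_eq, hp a]
  exact hq.isHamiltonian_of_adj hV hv.symm

/-- In a nonhamiltonian graph, the endpoints of a Hamiltonian path have degree sum less than the
number of vertices. -/
theorem Walk.IsHamiltonian.degree_add_degree_lt [DecidableRel G.Adj] {p : G.Walk v u}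
    (hp : p.IsHamiltonian) (hV : 3 ≤ Fintype.card V) (hG : ¬ G.IsHamiltonian) :
    G.degree u + G.degree v < Fintype.card V := by
  have hlen := hp.length_eq
  let A := {i ∈ Finset.range p.length | G.Adj u (p.getVert i)}
  let B := {i ∈ Finset.range p.length | G.Adj v (p.getVert (i + 1))}
  have hA : G.degree u ≤ A.card := by
    refine (Finset.card_le_card (t := A.image p.getVert) fun w hw ↦ ?_).trans
      Finset.card_image_le
    obtain ⟨i, rfl, hi⟩ := Walk.mem_support_iff_exists_getVert.1 (hp.mem_support w)
    rw [mem_neighborFinset] at hw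
    refine Finset.mem_image_of_mem _ (Finset.mem_filter.2 ⟨Finset.mem_range.2 ?_, hw⟩)
    refine lt_of_le_of_ne hi fun h ↦ ?_
    rw [h, Walk.getVert_length] at hw
    exact hw.ne rfl
  have hB : G.degree v ≤ B.card := by
    refine (Finset.card_le_card (t := B.image fun i ↦ p.getVert (i + 1)) fun w hw ↦ ?_).trans
      Finset.card_image_le
    obtain ⟨i, rfl, hi⟩ := Walk.mem_support_iff_exists_getVert.1 (hp.mem_support w)
    rw [mem_neighborFinset] at hw
    cases i with
    | zero => exact (hw.ne p.getVert_zero.symm).elim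
    | succ i =>
      exact Finset.mem_image.2 ⟨i, Finset.mem_filter.2 ⟨Finset.mem_range.2 hi, hw⟩, rfl⟩
  have hAB : Disjoint A B := Finset.disjoint_left.2 fun i hiA hiB ↦ by
    simp only [A, B, Finset.mem_filter, Finset.mem_range] at hiA hiB
    exact hG (hp.isHamiltonian_of_crossing hV hiA.1 hiA.2 hiB.2)
  have hcard : (A ∪ B).card ≤ p.length := by
    simpa using Finset.card_le_card (t := Finset.range p.length)
      (Finset.union_subset (Finset.filter_subset _ _) (Finset.filter_subset _ _))
  rw [Finset.card_union_of_disjoint hAB] at hcard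
  omega

/-- If adding the edge `uv` creates a Hamiltonian cycle, then `u` and `v` are joined by a
Hamiltonian path. -/
theorem exists_isHamiltonian_walk_of_sup_edge (hne : u ≠ v) (hG : ¬ G.IsHamiltonian)
    (h : (G ⊔ edge u v).IsHamiltonian) : ∃ p : G.Walk v u, p.IsHamiltonian := by
  have : Nontrivial V := ⟨u, v, hne⟩
  have hsub {e : Sym2 V} (he : e ∈ (G ⊔ edge u v).edgeSet) (hn : e ≠ s(u, v)) : e ∈ G.edgeSet := by
    rw [edgeSet_sup, edgeSet_edge_of_ne hne] at he
    exact he.resolve_right hn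
  have of_snd {c : (G ⊔ edge u v).Walk u u} (hc : c.IsHamiltonianCycle) (hs : c.snd = v) :
      ∃ p : G.Walk v u, p.IsHamiltonian := by
    cases c with
    | nil => exact (hc.isCycle.not_nil .nil).elim
    | cons hadj q =>
      rw [Walk.snd_cons] at hs
      subst hs
      have hnot := ((Walk.cons_isCycle_iff _ _).1 hc.isCycle).2
      refine ⟨q.transfer G fun e he ↦ hsub (q.edges_subset_edgeSet he) fun h ↦ hnot (h ▸ he), ?_⟩
      have := hc.isHamiltonian_tail
      intro a
      simpa using this a
  obtain ⟨c, hc⟩ := h.exists_isHamiltonianCycle u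
  by_cases hmem : s(u, v) ∈ c.edges
  · by_cases hs : c.snd = v
    · exact of_snd hc hs
    · refine of_snd (c := c.reverse) ?_ ?_
      · rw [Walk.isHamiltonianCycle_iff_isCycle_and_length_eq]
        exact ⟨hc.isCycle.reverse, by simpa using hc.length_eq⟩
      · cases c with
        | nil => exact (hc.isCycle.not_nil .nil).elim
        | cons hadj q =>
          have hq := ((Walk.cons_isCycle_iff _ _).1 hc.isCycle)
          have hmem' : s(u, v) ∈ q.edges := by
            rw [Walk.edges_cons, List.mem_cons] at hmem
            refine hmem.resolve_left fun h ↦ hs ?_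
            rw [Walk.snd_cons]
            exact (Sym2.congr_right.1 h).symm
          have := hq.1.eq_penultimate_of_mem_edges hmem'
          rw [Walk.snd_reverse, Walk.penultimate_cons_of_not_nil]
          · exact this.symm
          intro hn
          rw [Walk.edges_eq_nil.2 hn] at hmem'
          exact List.not_mem_nil hmem'
  · refine (hG fun _ ↦ ⟨u, c.transfer G fun e he ↦
      hsub (c.edges_subset_edgeSet he) fun h ↦ hmem (h ▸ he), ?_⟩).elim
    rw [Walk.isHamiltonianCycle_iff_isCycle_and_length_eq]
    exact ⟨hc.isCycle.transfer _, by simpa using hc.length_eq⟩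

theorem isHamiltonian_top_fin {n : ℕ} (hn : 3 ≤ n) : (⊤ : SimpleGraph (Fin n)).IsHamiltonian := by
  obtain ⟨m, rfl⟩ := Nat.exists_eq_add_of_le' hn
  have h : (cycleGraph (m + 3)).IsHamiltonian := fun _ ↦
    ⟨_, cycleGraph.cycle m, Walk.isHamiltonianCycle_iff_isCycle_and_length_eq.2
      ⟨cycleGraph.isCycle_cycle, by simp [cycleGraph.length_cycle]⟩⟩
  exact h.mono le_top

/-- Ore's degree condition for an edge-maximal nonhamiltonian graph. -/
theorem degree_add_degree_lt_of_maximal [DecidableRel G.Adj] (hV : 3 ≤ Fintype.card V)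
    (hG : Maximal (fun H : SimpleGraph V ↦ ¬ H.IsHamiltonian) G) (hne : u ≠ v)
    (hadj : ¬ G.Adj u v) : G.degree u + G.degree v < Fintype.card V := by
  have h : (G ⊔ edge u v).IsHamiltonian := by
    by_contra h
    exact (G.lt_sup_edge _ _ hne hadj).not_ge (hG.le_of_ge h le_sup_left)
  obtain ⟨p, hp⟩ := exists_isHamiltonian_walk_of_sup_edge hne hG.prop h
  exact hp.degree_add_degree_lt hV hG.prop

end Hamiltonian

section EdgeCount

variable {V : Type*} [Fintype V] [DecidableEq V] (G : SimpleGraph V) [DecidableRel G.Adj]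

theorem card_edgeFinset_le_of_degree_le (S : Finset V) {k : ℕ} (hS : ∀ v ∈ S, G.degree v ≤ k) :
    G.edgeFinset.card ≤ (Fintype.card V - S.card).choose 2 + S.card * k := by
  have hsub : G.edgeFinset ⊆
      (Sᶜ).offDiag.image Sym2.mk.uncurry ∪ S.biUnion fun v ↦ G.incidenceFinset v := by
    intro e he
    induction e with | h a b
    rw [mem_edgeFinset, mem_edgeSet] at he
    rw [Finset.mem_union, or_iff_not_imp_right]
    intro hn
    have hn' {v : V} (hv : v ∈ s(a, b)) : v ∉ S := fun hvS ↦
      hn (Finset.mem_biUnion.2 ⟨v, hvS, (G.mem_incidenceFinset v _).2 ⟨he, hv⟩⟩)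
    exact Finset.mem_image.2 ⟨(a, b), Finset.mem_offDiag.2
      ⟨Finset.mem_compl.2 (hn' (Sym2.mem_mk_left a b)),
        Finset.mem_compl.2 (hn' (Sym2.mem_mk_right a b)), he.ne⟩, rfl⟩
  refine (Finset.card_le_card hsub).trans ((Finset.card_union_le _ _).trans ?_)
  rw [Sym2.card_image_offDiag, Finset.card_compl]
  gcongr
  exact Finset.card_biUnion_le_card_mul _ _ _ fun v hv ↦ by
    rw [card_incidenceFinset_eq_degree]
    exact hS v hv

/-- An edge-maximal nonhamiltonian graph on `n` vertices has, for some `k < n / 2` that is the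
degree of a vertex, a set of `k` vertices of degree at most `k`. -/
theorem exists_card_eq_degree_le_of_maximal {n : ℕ} (hn : 3 ≤ n) {G : SimpleGraph (Fin n)}
    [DecidableRel G.Adj] (hG : Maximal (fun H : SimpleGraph (Fin n) ↦ ¬ H.IsHamiltonian) G) :
    ∃ u, 2 * G.degree u < n ∧
      ∃ S : Finset (Fin n), S.card = G.degree u ∧ ∀ w ∈ S, G.degree w ≤ G.degree u := by
  let P : Finset (Fin n × Fin n) := {x | x.1 ≠ x.2 ∧ ¬ G.Adj x.1 x.2}
  have hP : P.Nonempty := by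
    by_contra h
    refine hG.prop ?_
    have : G = ⊤ := by
      ext a b
      rw [top_adj]
      refine ⟨Adj.ne, fun hab ↦ ?_⟩
      by_contra hnab
      exact h ⟨(a, b), by simp [P, hab, hnab]⟩
    rw [this]
    exact isHamiltonian_top_fin hn
  obtain ⟨⟨u, v⟩, hmem, hmax⟩ := P.exists_max_image (fun x ↦ G.degree x.1 + G.degree x.2) hP
  simp only [P, Finset.mem_filter_univ] at hmem hmax
  wlog huv : G.degree u ≤ G.degree v generalizing u v
  · refine this v u ⟨hmem.1.symm, fun h ↦ hmem.2 h.symm⟩ (fun x hx ↦ ?_) (le_of_not_ge huv)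
    rw [add_comm (G.degree v)]
    exact hmax x hx
  have hlt := degree_add_degree_lt_of_maximal (by simpa using hn) hG hmem.1 hmem.2
  rw [Fintype.card_fin] at hlt
  let T := (insert v (G.neighborFinset v))ᶜ
  have hT : G.degree u ≤ T.card := by
    rw [Finset.card_compl, Finset.card_insert_of_notMem (by simp), card_neighborFinset_eq_degree,
      Fintype.card_fin]
    omega
  obtain ⟨S, hST, hS⟩ := Finset.exists_subset_card_eq hT
  refine ⟨u, by omega, S, hS, fun w hw ↦ ?_⟩
  have hwT := hST hw
  simp only [T, Finset.mem_compl, Finset.mem_insert, mem_neighborFinset, not_or] at hwT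
  have := hmax (w, v) ⟨hwT.1, fun h ↦ hwT.2 h.symm⟩
  dsimp only at this
  omega

end EdgeCount

end SimpleGraph

theorem two_mul_erdosH {n k : ℕ} (hk : k ≤ n) :
    (2 * erdosH n k : ℤ) = 3 * k ^ 2 - (2 * n - 1) * k + n * (n - 1) := by
  obtain ⟨m, rfl⟩ := Nat.exists_eq_add_of_le hk
  have h : ((m.choose 2 : ℕ) : ℤ) * 2 = m * (m - 1) := by
    cases m with
    | zero => simp
    | succ m =>
      have h := Nat.add_one_mul_choose_eq m 1
      rw [Nat.choose_one_right] at h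
      zify at h
      push_cast
      linarith
  rw [erdosH, Nat.add_sub_cancel_left]
  push_cast
  linarith

/-- By convexity, `erdosH n` is bounded on an interval by its values at the endpoints. -/
theorem erdosH_le_max {n d k m : ℕ} (hdk : d ≤ k) (hkm : k ≤ m) (hmn : m ≤ n) :
    erdosH n k ≤ max (erdosH n d) (erdosH n m) := by
  by_contra! h
  obtain ⟨hd, hm⟩ := max_lt_iff.1 h
  have hk := two_mul_erdosH (hkm.trans hmn)
  have hd' := two_mul_erdosH ((hdk.trans hkm).trans hmn)
  have hm' := two_mul_erdosH hmn
  zify at hd hm hdk hkm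
  have h₁ : (0 : ℤ) < (k - d) * (3 * (k + d) - (2 * n - 1)) := by linarith
  have h₂ : (m - k) * (3 * (m + k) - (2 * n - 1)) < (0 : ℤ) := by linarith
  have h₃ := pos_of_mul_pos_right h₁ (sub_nonneg.2 hdk)
  have h₄ := neg_of_mul_neg_right h₂ (sub_nonneg.2 hkm)
  linarith

theorem erdos_nonhamiltonian_edge_bound (n d : ℕ) (hd1 : 1 ≤ d) (hd2 : d ≤ (n - 1) / 2)
    (G : SimpleGraph (Fin n)) [DecidableRel G.Adj]
    (hδ : ∀ v, d ≤ G.degree v) (hG : ¬ G.IsHamiltonian) :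
    G.edgeFinset.card ≤ max (erdosH n d) (erdosH n ((n - 1) / 2)) := by
  classical
  obtain ⟨H, hGH, hH⟩ := Finite.exists_le_maximal
    (p := fun H : SimpleGraph (Fin n) ↦ ¬ H.IsHamiltonian) hG
  obtain ⟨u, hu, S, hS, hdeg⟩ := SimpleGraph.exists_card_eq_degree_le_of_maximal (by omega) hH
  have hdu : d ≤ H.degree u := (hδ u).trans (SimpleGraph.degree_le_of_le hGH)
  have hedge := H.card_edgeFinset_le_of_degree_le S hdeg
  rw [hS, Fintype.card_fin, ← sq] at hedge
  exact ((Finset.card_le_card (SimpleGraph.edgeFinset_mono hGH)).trans hedge).trans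
    (erdosH_le_max hdu (by omega) (by omega))
end

section
/- Let G be a saturated nonhamiltonian graph on n vertices, and suppose G contains a set D of exactly δ(G) vertices, each of degree at most δ(G), such that G - D is a complete graph, where δ(G) ≤ ⌊(n-1)/2⌋. Then G = H_{n,δ(G)} or G = K'_{n,δ(G)}. -/
/-- The graph `H_{n,d}`: a clique `A = {0,…,n-d-1}` together with `d` further vertices
`{n-d,…,n-1}`, each adjacent to the same `d` vertices `{0,…,d-1}` of `A`. -/
def Hnd (n d : ℕ) : SimpleGraph (Fin n) :=
  SimpleGraph.fromRel (fun x y =>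
    (x.val < n - d ∧ y.val < n - d) ∨ (x.val < d ∧ n - d ≤ y.val))

/-- The graph `K'_{n,d}`: an edge-disjoint union of a clique on `{0,…,n-d-1}` and a clique
on `{n-d-1,…,n-1}` sharing the single vertex `n-d-1`. -/
def Knd' (n d : ℕ) : SimpleGraph (Fin n) :=
  SimpleGraph.fromRel (fun x y =>
    (x.val < n - d ∧ y.val < n - d) ∨ (n - d - 1 ≤ x.val ∧ n - d - 1 ≤ y.val))

/-- A graph is saturated if it is nonhamiltonian but adding any missing edge
creates a Hamiltonian cycle. -/
def SaturatedNonhamiltonian {V : Type*} [Fintype V] [DecidableEq V] (G : SimpleGraph V) : Prop :=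
  ¬ G.IsHamiltonian ∧
    ∀ u v : V, u ≠ v → ¬ G.Adj u v → (G ⊔ SimpleGraph.edge u v).IsHamiltonian

namespace SimpleGraph

open Finset List

variable {V : Type*}

/-- A list traversing every vertex exactly once in which cyclically consecutive entries are
adjacent. -/
def IsHamiltonianList (G : SimpleGraph V) (l : List V) : Prop :=
  l.Nodup ∧ (∀ v, v ∈ l) ∧ (l : Cycle V).Chain G.Adj

lemma cycle_chain_iff_getElem {r : V → V → Prop} {l : List V} :
    (l : Cycle V).Chain r ↔
      ∀ i (h : i < l.length), r l[i] (l[(i + 1) % l.length]'(Nat.mod_lt _ (by omega))) := by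
  cases l with
  | nil => simp
  | cons a l =>
    rw [Cycle.chain_coe_cons, List.isChain_iff_getElem]
    have key : ∀ i (h : i < (a :: l).length),
        (a :: (l ++ [a]))[i]'(by simp at h ⊢; omega) = (a :: l)[i] ∧
        (a :: (l ++ [a]))[i + 1]'(by simp at h ⊢; omega) =
          (a :: l)[(i + 1) % (a :: l).length]'(Nat.mod_lt _ (by simp)) := by
      intro i hi
      have hi' : i < l.length + 1 := by simpa using hi
      refine ⟨List.getElem_append_left (as := a :: l) (bs := [a]) hi, ?_⟩
      by_cases h : i = l.length
      · subst h
        simp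
      · simp only [List.length_cons, Nat.mod_eq_of_lt (show i + 1 < l.length + 1 by omega)]
        exact List.getElem_append_left (as := a :: l) (bs := [a]) (by simp; omega)
    constructor
    · intro H i hi
      rw [← (key i hi).1, ← (key i hi).2]
      exact H i (by simp at hi ⊢; omega)
    · intro H i hi
      have hi' : i < (a :: l).length := by simpa using hi
      rw [(key i hi').1, (key i hi').2]
      exact H i hi'

section

variable [Fintype V] [DecidableEq V] {G : SimpleGraph V}

lemma IsHamiltonianList.length_eq {l : List V} (h : G.IsHamiltonianList l) :
    l.length = Fintype.card V := by
  rw [← List.toFinset_card_of_nodup h.1, ← Finset.card_univ]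
  congr 1
  ext v
  simpa using h.2.1 v

lemma IsHamiltonian.exists_isHamiltonianList (h : G.IsHamiltonian) (hV : Fintype.card V ≠ 1) :
    ∃ l, G.IsHamiltonianList l := by
  obtain ⟨a, p, hp⟩ := h hV
  cases p with
  | nil => exact absurd rfl hp.1.ne_nil
  | cons hab q =>
    have hq : q.IsHamiltonian := by simpa [Walk.IsHamiltonian] using hp.isHamiltonian_tail
    refine ⟨q.support, hq.isPath.support_nodup, hq.mem_support, ?_⟩
    rw [Cycle.chain_ne_nil _ q.support_ne_nil, Walk.getLast_support]
    exact q.isChain_adj_cons_support hab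

lemma IsHamiltonianList.isHamiltonian {l : List V} (h : G.IsHamiltonianList l)
    (hV : 3 ≤ Fintype.card V) : G.IsHamiltonian := by
  have hl := h.length_eq
  obtain ⟨hnd, hmem, hch⟩ := h
  intro _
  have hne : l ≠ [] := by rintro rfl; simp at hl; omega
  rw [Cycle.chain_ne_nil _ hne] at hch
  have hc2 : l.IsChain G.Adj := hch.tail
  let q := Walk.ofSupport l hne hc2
  have hqs : q.support = l := Walk.support_ofSupport _ _
  have hadj : G.Adj (l.getLast hne) (l.head hne) := by
    cases l with
    | nil => exact absurd rfl hne
    | cons a l => exact hch.rel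
  have hqp : q.IsPath := Walk.IsPath.mk' (by rw [hqs]; exact hnd)
  have hlen : q.length = l.length - 1 := Walk.length_ofSupport _ _
  refine ⟨_, Walk.cons hadj q, ?_⟩
  rw [Walk.isHamiltonianCycle_iff_isCycle_and_length_eq]
  constructor
  · rw [Walk.cons_isCycle_iff]
    refine ⟨hqp, fun he => ?_⟩
    rw [Sym2.eq_swap] at he
    have := hqp.length_eq_one_of_mem_edges he
    omega
  · simp; omega

end

lemma exists_chain_reverse_of_crossing {G : SimpleGraph V} {l : List V} (hch : l.IsChain G.Adj)
    (i : ℕ) (hi : i + 1 < l.length) (h1 : G.Adj l[0] l[i + 1])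
    (h2 : G.Adj l[i] l[l.length - 1]) :
    ((l.take (i + 1) ++ (l.drop (i + 1)).reverse : List V) : Cycle V).Chain G.Adj := by
  rw [Cycle.chain_ne_nil _ (by simp; omega)]
  have hlast : (l.take (i + 1) ++ (l.drop (i + 1)).reverse).getLast (by simp; omega) = l[i + 1] := by
    rw [List.getLast_append_of_ne_nil _ (by simp; omega)]
    simp
  rw [hlast, ← List.cons_append, List.isChain_append]
  refine ⟨?_, ?_, ?_⟩
  · cases l with
    | nil => simp at hi
    | cons a l =>
      simp only [List.take_succ_cons]
      rw [List.isChain_cons_cons]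
      refine ⟨h1.symm, ?_⟩
      rw [← List.take_succ_cons]
      exact hch.take _
  · rw [List.isChain_reverse]
    exact (hch.drop _).imp fun _ _ h => h.symm
  · intro x hx y hy
    have hx' : x = l[i] := by
      rw [List.getLast?_cons] at hx
      simp at hx
      grind
    have hy' : y = l[l.length - 1] := by
      rw [List.head?_reverse, List.getLast?_drop, if_neg (by omega),
        List.getLast?_eq_getElem?] at hy
      grind
    rw [hx', hy']
    exact h2

open Classical in
lemma exists_isHamiltonianList_of_sup_edge [Fintype V] {G : SimpleGraph V} {u v : V}
    (hV : 3 ≤ Fintype.card V) {l : List V} (hl : (G ⊔ edge u v).IsHamiltonianList l)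
    (hdeg : Fintype.card V ≤
      (univ.filter (G.Adj u)).card + (univ.filter (G.Adj v)).card) :
    ∃ l', G.IsHamiltonianList l' := by
  by_cases hc : (l : Cycle V).Chain G.Adj
  · exact ⟨l, hl.1, hl.2.1, hc⟩
  have hlen := hl.length_eq
  have hch := hl.2.2
  rw [cycle_chain_iff_getElem] at hc
  push Not at hc
  obtain ⟨i, hi, hnadj⟩ := hc
  have hadj := cycle_chain_iff_getElem.1 hch i hi
  obtain ⟨m, hlen', hnd', hmem', hch', hadj, hnadj⟩ : ∃ (m : List V)
      (hm : m.length = Fintype.card V), m.Nodup ∧ (∀ w, w ∈ m) ∧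
      (m : Cycle V).Chain (G ⊔ edge u v).Adj ∧
      (G ⊔ edge u v).Adj m[m.length - 1] m[0] ∧ ¬ G.Adj m[m.length - 1] m[0] := by
    have h0 : (l.rotate (i + 1))[0]'(by simp; omega) =
        l[(i + 1) % l.length]'(Nat.mod_lt _ (by omega)) := by
      simp [List.getElem_rotate]
    have h1 : (l.rotate (i + 1))[(l.rotate (i + 1)).length - 1]'(by simp; omega) = l[i] := by
      rw [List.getElem_rotate]
      congr 1
      rw [List.length_rotate, show l.length - 1 + (i + 1) = i + l.length by omega,
        Nat.add_mod_right, Nat.mod_eq_of_lt hi]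
    refine ⟨l.rotate (i + 1), by simpa using hlen, List.nodup_rotate.2 hl.1,
      fun w => List.mem_rotate.2 (hl.2.1 w), ?_, ?_, ?_⟩
    · rwa [Cycle.coe_eq_coe.2 (List.IsRotated.symm ⟨i + 1, rfl⟩ : l.rotate (i + 1) ~r l)]
    · rwa [h0, h1]
    · rwa [h0, h1]
  have hpath : m.IsChain G.Adj := by
    rw [List.isChain_iff_getElem]
    intro k hk
    have h := cycle_chain_iff_getElem.1 hch' k (by omega)
    simp only [Nat.mod_eq_of_lt hk] at h
    by_contra hn
    have e1 := (sup_adj ..).1 h |>.resolve_left hn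
    have e2 := (sup_adj ..).1 hadj |>.resolve_left hnadj
    rw [edge_adj] at e1 e2
    have i1 : m[k] = m[0] → k = 0 := fun h => (hnd'.getElem_inj_iff).1 h
    have i2 : m[k] = m[m.length - 1] → k = m.length - 1 := fun h => (hnd'.getElem_inj_iff).1 h
    have i3 : m[k + 1] = m[0] → k + 1 = 0 := fun h => (hnd'.getElem_inj_iff).1 h
    have i4 : m[k + 1] = m[m.length - 1] → k + 1 = m.length - 1 :=
      fun h => (hnd'.getElem_inj_iff).1 h
    grind
  have hdeg' : Fintype.card V ≤ (univ.filter (G.Adj m[0])).card +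
      (univ.filter (G.Adj m[m.length - 1])).card := by
    have e2 := (sup_adj ..).1 hadj |>.resolve_left hnadj
    rw [edge_adj] at e2
    obtain ⟨⟨a, b⟩ | ⟨a, b⟩, -⟩ := e2
    · rw [a, b]; omega
    · rw [a, b]; omega
  obtain ⟨j, hj, hj1, hj2⟩ : ∃ (j : ℕ) (hj : j + 1 < m.length),
      G.Adj m[0] m[j + 1] ∧ G.Adj m[j] m[m.length - 1] := by
    let S := (univ : Finset (Fin (m.length - 1))).filter fun j => G.Adj m[0] m[j.1 + 1]
    let T := (univ : Finset (Fin (m.length - 1))).filter fun j => G.Adj m[j.1] m[m.length - 1]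
    have hS : (univ.filter (G.Adj m[0])).card ≤ S.card := by
      refine (card_le_card ?_).trans (card_image_le (f := fun j => m[j.1 + 1]))
      intro w hw
      obtain ⟨k, hk, rfl⟩ := List.getElem_of_mem (hmem' w)
      have hw' : G.Adj m[0] m[k] := by simpa using hw
      cases k with
      | zero => exact absurd hw' (G.irrefl)
      | succ k =>
        exact mem_image.2 ⟨⟨k, by omega⟩, by simpa [S] using hw', rfl⟩
    have hT : (univ.filter (G.Adj m[m.length - 1])).card ≤ T.card := by
      refine (card_le_card ?_).trans (card_image_le (f := fun j => m[j.1]))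
      intro w hw
      obtain ⟨k, hk, rfl⟩ := List.getElem_of_mem (hmem' w)
      have hw' : G.Adj m[m.length - 1] m[k] := by simpa using hw
      have hk' : k ≠ m.length - 1 := by
        rintro rfl
        exact G.irrefl hw'
      exact mem_image.2 ⟨⟨k, by omega⟩, by simpa [T] using hw'.symm, rfl⟩
    have hU : (S ∪ T).card ≤ m.length - 1 := by
      simpa using card_le_univ (S ∪ T)
    have hI : 0 < (S ∩ T).card := by
      have := card_union_add_card_inter S T
      omega
    obtain ⟨j, hj⟩ := card_pos.1 hI
    rw [mem_inter] at hj
    exact ⟨j, by omega, by simpa [S] using hj.1, by simpa [T] using hj.2⟩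
  have hperm : (m.take (j + 1) ++ (m.drop (j + 1)).reverse).Perm m := by
    conv_rhs => rw [← List.take_append_drop (j + 1) m]
    exact (List.reverse_perm _).append_left _
  exact ⟨_, hperm.nodup_iff.2 hnd', fun w => hperm.mem_iff.2 (hmem' w),
    exists_chain_reverse_of_crossing hpath j hj hj1 hj2⟩

open Classical in
/-- **Dirac theorem**: a graph of minimum degree at least half its order is Hamiltonian. -/
lemma exists_isHamiltonianList_of_card_le_two_mul_degree [Fintype V]
    (hV : 3 ≤ Fintype.card V) (G : SimpleGraph V)
    (hG : ∀ v, Fintype.card V ≤ 2 * (univ.filter (G.Adj v)).card) :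
    ∃ l, G.IsHamiltonianList l := by
  induction G using WellFoundedGT.induction with
  | ind G ih =>
  by_cases hT : G = ⊤
  · subst hT
    refine ⟨univ.toList, nodup_toList _, by simp, ?_⟩
    rw [cycle_chain_iff_getElem]
    intro i hi
    rw [top_adj]
    intro h
    have h' := ((nodup_toList _).getElem_inj_iff).1 h
    have hl : 3 ≤ (univ : Finset V).toList.length := by simpa using hV
    by_cases hi' : i + 1 = (univ : Finset V).toList.length
    · rw [hi', Nat.mod_self] at h'
      omega
    · rw [Nat.mod_eq_of_lt (by omega)] at h'
      omega
  · obtain ⟨u, v, huv, hn⟩ := ne_top_iff_exists_not_adj.1 hT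
    have hlt : G < G ⊔ edge u v := G.lt_sup_edge u v huv hn
    obtain ⟨l, hl⟩ := ih _ hlt fun w => (hG w).trans <| by
      gcongr with x
      exact fun h => Or.inl h
    refine exists_isHamiltonianList_of_sup_edge hV hl ?_
    have h1 := hG u
    have h2 := hG v
    omega

open Classical in
lemma exists_isHamiltonianList_of_compl_clique [Fintype V] {G : SimpleGraph V} {D B : Finset V}
    (hBD : Disjoint D B) (hB : 2 ≤ B.card) (hlt : B.card < D.card)
    (hclique : ∀ u v, u ∉ D → v ∉ D → u ≠ v → G.Adj u v)
    (hjoin : ∀ u ∈ B, ∀ v ∈ D, G.Adj u v)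
    (hdeg : ∀ v ∈ D, D.card ≤ B.card + (D.filter (G.Adj v)).card) :
    ∃ l, G.IsHamiltonianList l := by
  have hBD' : ∀ x ∈ B, x ∉ D := fun x hx hx' => Finset.disjoint_left.1 hBD hx' hx
  obtain ⟨b, hb⟩ : B.Nonempty := card_pos.1 (by omega)
  let S := D ∪ B.erase b
  have hdisj : Disjoint D (B.erase b) := hBD.mono_right (erase_subset _ _)
  have herase : (B.erase b).card = B.card - 1 := card_erase_of_mem hb
  have hScard : S.card = D.card + (B.card - 1) := by
    rw [card_union_of_disjoint hdisj, herase]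
  have hbS : b ∉ S := by simp [S, hBD' b hb]
  have hBS : ∀ x ∈ B, ∀ y ∈ S, x ≠ y → G.Adj x y := by
    intro x hx y hy hxy
    rcases mem_union.1 hy with hy | hy
    · exact hjoin x hx y hy
    · exact hclique x y (hBD' x hx) (hBD' y (mem_of_mem_erase hy)) hxy
  have hSdeg : ∀ v ∈ S, S.card ≤ 2 * (S.filter (G.Adj v)).card := by
    intro v hv
    rcases mem_union.1 hv with hv' | hv'
    · have hsub : B.erase b ∪ D.filter (G.Adj v) ⊆ S.filter (G.Adj v) := by
        intro x hx
        rcases mem_union.1 hx with hx | hx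
        · exact mem_filter.2 ⟨mem_union_right _ hx,
            (hjoin x (mem_of_mem_erase hx) v hv').symm⟩
        · exact mem_filter.2 ⟨mem_union_left _ (mem_filter.1 hx).1, (mem_filter.1 hx).2⟩
      have h1 := card_le_card hsub
      rw [card_union_of_disjoint (hdisj.symm.mono_right (filter_subset _ _)), herase] at h1
      have h2 := hdeg v hv'
      omega
    · have hsub : S.erase v ⊆ S.filter (G.Adj v) := by
        intro x hx
        rw [mem_erase] at hx
        exact mem_filter.2 ⟨hx.2, hBS v (mem_of_mem_erase hv') x hx.2 hx.1.symm⟩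
      have h1 := card_le_card hsub
      rw [card_erase_of_mem hv] at h1
      omega
  obtain ⟨l, hnd, hmem, hch⟩ :=
    exists_isHamiltonianList_of_card_le_two_mul_degree (V := S) (by simp; omega)
      (G.comap Subtype.val) (by
        intro v
        rw [Fintype.card_coe]
        refine (hSdeg v v.2).trans (Nat.mul_le_mul_left 2 ?_)
        refine le_trans (card_le_card ?_) (card_image_le (f := Subtype.val))
        intro x hx
        rw [Finset.mem_filter] at hx
        exact mem_image.2 ⟨⟨x, hx.1⟩, by simpa using hx.2, rfl⟩)
  obtain ⟨c, hc⟩ : (B.erase b).Nonempty := card_pos.1 (by omega)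
  have hcS : c ∈ S := mem_union_right _ hc
  obtain ⟨s, t, rfl⟩ := List.append_of_mem (hmem ⟨c, hcS⟩)
  have hch2 : ((⟨c, hcS⟩ :: (t ++ s) : List S) : Cycle S).Chain
      fun x y => G.Adj x.1 y.1 := by
    rw [← List.cons_append, Cycle.coe_eq_coe.2 List.isRotated_append]
    exact hch
  rw [← Cycle.chain_map (r := G.Adj) Subtype.val, Cycle.map_coe, List.map_cons,
    Cycle.chain_coe_cons] at hch2
  have hperm : (⟨c, hcS⟩ :: (t ++ s) : List S).Perm (s ++ ⟨c, hcS⟩ :: t) := by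
    rw [← List.cons_append]
    exact List.perm_append_comm
  have hnd2 : (c :: (t ++ s).map Subtype.val).Nodup := by
    have := (hperm.nodup_iff.2 hnd).map Subtype.val_injective
    simpa using this
  have hmem2 : ∀ x, x ∈ c :: (t ++ s).map Subtype.val ↔ x ∈ S := by
    intro x
    rw [show c :: (t ++ s).map Subtype.val =
      (⟨c, hcS⟩ :: (t ++ s) : List S).map Subtype.val from rfl, List.mem_map]
    exact ⟨fun ⟨y, _, hy⟩ => hy ▸ y.2, fun hx => ⟨⟨x, hx⟩, hperm.mem_iff.2 (hmem _), rfl⟩⟩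
  simp only at hch2
  generalize (t ++ s).map Subtype.val = p at *
  have hcB : c ∈ B := mem_of_mem_erase hc
  let R := (univ \ insert b S).toList
  have hR : ∀ x, x ∈ R ↔ x ≠ b ∧ x ∉ S := by simp [R]
  have hSD : ∀ x, x ∉ S → x ∉ D := fun x hx hx' => hx (mem_union_left _ hx')
  have hRb : ∀ x ∈ R ++ [b], x ∉ S := by
    intro x hx
    rcases List.mem_append.1 hx with hx | hx
    · exact ((hR x).1 hx).2
    · rwa [List.mem_singleton.1 hx]
  have hndR : (R ++ [b]).Nodup := by
    rw [List.nodup_append]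
    refine ⟨nodup_toList _, List.nodup_singleton _, ?_⟩
    intro x hx y hy
    rw [List.mem_singleton.1 hy]
    exact ((hR x).1 hx).1
  have hperm2 : (b :: (p ++ [c] ++ R)).Perm ((c :: p) ++ (R ++ [b])) := by
    refine (List.perm_append_singleton b _).symm.trans ?_
    rw [List.append_assoc]
    exact (List.perm_append_singleton c p).append_right _
  refine ⟨b :: (p ++ [c] ++ R), hperm2.nodup_iff.2 ?_, fun x => hperm2.mem_iff.2 ?_, ?_⟩
  · rw [List.nodup_append]
    refine ⟨hnd2, hndR, ?_⟩
    rintro x hx y hy rfl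
    exact hRb x hy ((hmem2 x).1 hx)
  · rw [List.mem_append, hmem2, List.mem_append, hR, List.mem_singleton]
    tauto
  · rw [Cycle.chain_coe_cons, List.append_assoc, ← List.cons_append, List.isChain_append]
    refine ⟨?_, ?_, ?_⟩
    · rw [List.isChain_cons]
      refine ⟨fun y hy => ?_, hch2.tail⟩
      have hyS : y ∈ S := (hmem2 y).1 <|
        (List.perm_append_singleton c p).mem_iff.1 (List.mem_of_mem_head? hy)
      exact hBS b hb y hyS fun h => hbS (h ▸ hyS)
    · refine (hndR.imp_of_mem fun {x y} hx hy hxy => ?_).isChain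
      exact hclique x y (hSD x (hRb x hx)) (hSD y (hRb y hy)) hxy
    · intro x hx y hy
      rw [← List.cons_append, List.getLast?_append] at hx
      obtain rfl : c = x := by simpa using hx
      have hy' := hRb y (List.mem_of_mem_head? hy)
      exact hclique c y (hBD' c hcB) (hSD y hy') fun h => hy' (h ▸ hcS)

end SimpleGraph

open Classical in
lemma SaturatedNonhamiltonian.adj_of_card_le [Fintype V] [DecidableEq V]
    {G : SimpleGraph V} (hG : SaturatedNonhamiltonian G) (hV : 3 ≤ Fintype.card V) {u v : V}
    (huv : u ≠ v) (hdeg : Fintype.card V ≤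
      (Finset.univ.filter (G.Adj u)).card + (Finset.univ.filter (G.Adj v)).card) :
    G.Adj u v := by
  by_contra h
  obtain ⟨l, hl⟩ := (hG.2 u v huv h).exists_isHamiltonianList (by omega)
  obtain ⟨l', hl'⟩ := SimpleGraph.exists_isHamiltonianList_of_sup_edge hV hl hdeg
  exact hG.1 (hl'.isHamiltonian hV)

open Finset in
lemma Finset.exists_perm_mem_iff_mem_iff {α : Type*} [Fintype α] [DecidableEq α]
    {P Q P' Q' : Finset α} (hPQ : Disjoint P Q) (hPQ' : Disjoint P' Q')
    (hP : P.card = P'.card) (hQ : Q.card = Q'.card) :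
    ∃ e : α ≃ α, ∀ x, (x ∈ P ↔ e x ∈ P') ∧ (x ∈ Q ↔ e x ∈ Q') := by
  let f (P Q : Finset α) (x : α) : Option Bool :=
    if x ∈ P then some true else if x ∈ Q then some false else none
  have h1 (P Q : Finset α) (x : α) : x ∈ P ↔ f P Q x = some true := by
    simp only [f]
    split_ifs <;> simp_all
  have h2 {P Q : Finset α} (h : Disjoint P Q) (x : α) : x ∈ Q ↔ f P Q x = some false := by
    have hx : x ∈ P → x ∉ Q := fun hx => Finset.disjoint_left.1 h hx
    simp only [f]
    split_ifs <;> simp_all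
  have h3 (P Q : Finset α) (x : α) : x ∈ (P ∪ Q)ᶜ ↔ f P Q x = none := by
    simp only [f]
    split_ifs <;> simp_all
  have key : ∀ c, Nonempty ({a // f P Q a = c} ≃ {b // f P' Q' b = c}) := by
    intro c
    rw [← Fintype.card_eq]
    match c with
    | some true =>
      rw [Fintype.card_of_subtype P (h1 P Q), Fintype.card_of_subtype P' (h1 P' Q'), hP]
    | some false =>
      rw [Fintype.card_of_subtype Q (h2 hPQ), Fintype.card_of_subtype Q' (h2 hPQ'), hQ]
    | none =>
      rw [Fintype.card_of_subtype _ (h3 P Q), Fintype.card_of_subtype _ (h3 P' Q'),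
        card_compl, card_compl, card_union_of_disjoint hPQ, card_union_of_disjoint hPQ', hP, hQ]
  let e := Equiv.ofFiberEquiv fun c => (key c).some
  have he : ∀ x, f P' Q' (e x) = f P Q x := fun x => Equiv.ofFiberEquiv_map _ x
  refine ⟨e, fun x => ?_⟩
  rw [h1 P Q, h1 P' Q', h2 hPQ, h2 hPQ', he]
  simp

lemma Fin.card_filter_le_val (n m : ℕ) :
    (Finset.univ.filter fun x : Fin n => m ≤ x.val).card = n - m := by
  have h : (Finset.univ.filter fun x : Fin n => m ≤ x.val) =
      (Finset.univ.filter fun x : Fin n => x.val < m)ᶜ := by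
    ext x
    simp
  rw [h, Finset.card_compl, Fin.card_filter_val_lt, Fintype.card_fin]
  omega

lemma nonempty_iso_Hnd {n d : ℕ} (hd : 2 * d ≤ n) {G : SimpleGraph (Fin n)}
    {D B : Finset (Fin n)} (hBD : Disjoint B D) (hD : D.card = d) (hB : B.card = d)
    (hG : ∀ x y, G.Adj x y ↔
      x ≠ y ∧ ((x ∉ D ∧ y ∉ D) ∨ (x ∈ B ∧ y ∈ D) ∨ (x ∈ D ∧ y ∈ B))) :
    Nonempty (G ≃g Hnd n d) := by
  obtain ⟨e, he⟩ := Finset.exists_perm_mem_iff_mem_iff hBD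
    (P' := Finset.univ.filter fun x : Fin n => x.val < d)
    (Q' := Finset.univ.filter fun x : Fin n => n - d ≤ x.val)
    (by rw [Finset.disjoint_filter]; intros; omega)
    (by rw [Fin.card_filter_val_lt]; omega)
    (by rw [Fin.card_filter_le_val]; omega)
  refine ⟨⟨e, fun {x y} => ?_⟩⟩
  have hx := he x
  have hy := he y
  simp only [Finset.mem_filter, Finset.mem_univ, true_and] at hx hy
  rw [hG, hx.1, hx.2, hy.1, hy.2, Hnd, SimpleGraph.fromRel_adj, e.injective.ne_iff]
  refine and_congr_right fun _ => ?_
  omega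

lemma nonempty_iso_Knd' {n d : ℕ} (hd : d < n) {G : SimpleGraph (Fin n)}
    {D : Finset (Fin n)} {w : Fin n} (hw : w ∉ D) (hD : D.card = d)
    (hG : ∀ x y, G.Adj x y ↔
      x ≠ y ∧ ((x ∉ D ∧ y ∉ D) ∨ ((x = w ∨ x ∈ D) ∧ (y = w ∨ y ∈ D)))) :
    Nonempty (G ≃g Knd' n d) := by
  obtain ⟨e, he⟩ := Finset.exists_perm_mem_iff_mem_iff
    (P := {w}) (Q := D) (by simpa using hw)
    (P' := {⟨n - d - 1, by omega⟩})
    (Q' := Finset.univ.filter fun x : Fin n => n - d ≤ x.val)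
    (by simp; omega)
    (by simp)
    (by rw [Fin.card_filter_le_val]; omega)
  refine ⟨⟨e, fun {x y} => ?_⟩⟩
  have hx := he x
  have hy := he y
  simp only [Finset.mem_filter, Finset.mem_univ, true_and, Finset.mem_singleton, Fin.ext_iff]
    at hx hy
  rw [hG, Fin.ext_iff (b := w), Fin.ext_iff (b := w), hx.1, hx.2, hy.1, hy.2, Knd',
    SimpleGraph.fromRel_adj, e.injective.ne_iff]
  refine and_congr_right fun _ => ?_
  omega

theorem saturated_min_degree_structure (n d : ℕ) (G : SimpleGraph (Fin n))
    [DecidableRel G.Adj] (hG : SaturatedNonhamiltonian G)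
    (hδ : ∀ v, d ≤ G.degree v) (hδ' : ∃ v, G.degree v = d)   -- d = δ(G)
    (hd2 : d ≤ (n - 1) / 2)
    (D : Finset (Fin n)) (hDcard : D.card = d) (hDdeg : ∀ v ∈ D, G.degree v ≤ d)
    (hcomplete : ∀ u v : Fin n, u ∉ D → v ∉ D → u ≠ v → G.Adj u v) :
    Nonempty (G ≃g Hnd n d) ∨ Nonempty (G ≃g Knd' n d) := by
  have hdeg_eq : ∀ v, G.degree v = (Finset.univ.filter (G.Adj v)).card := fun v => by
    rw [← G.card_neighborFinset_eq_degree, G.neighborFinset_eq_filter]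
  rcases Nat.eq_zero_or_pos d with rfl | hd
  · exfalso
    obtain ⟨v, hv⟩ := hδ'
    have hD : D = ∅ := Finset.card_eq_zero.1 hDcard
    have : Fintype.card (Fin n) ≠ 1 := fun h =>
      hG.1 (SimpleGraph.IsHamiltonian.of_card_eq_one h)
    obtain ⟨w, hw⟩ : ∃ w, w ≠ v := by
      by_contra! h
      exact this (Fintype.card_eq_one_iff.2 ⟨v, h⟩)
    have hvw : G.Adj v w := hcomplete v w (by simp [hD]) (by simp [hD]) hw.symm
    have := (G.degree_pos_iff_exists_adj v).2 ⟨w, hvw⟩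
    omega
  have hn : 2 * d + 1 ≤ n := by omega
  have hV : 3 ≤ Fintype.card (Fin n) := by simp; omega
  have hDeg : ∀ v ∈ D, G.degree v = d := fun v hv => le_antisymm (hDdeg v hv) (hδ v)
  have hall : ∀ w v, w ∉ D → v ∈ D → G.Adj w v → ∀ x ∈ D, G.Adj w x := by
    intro w v hw hv hwv x hx
    have hwx : w ≠ x := fun h => hw (h ▸ hx)
    refine hG.adj_of_card_le hV hwx ?_
    have hsub : insert v (Dᶜ.erase w) ⊆ Finset.univ.filter (G.Adj w) := by
      intro y hy
      rcases Finset.mem_insert.1 hy with rfl | hy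
      · simpa using hwv
      · simp only [Finset.mem_erase, Finset.mem_compl] at hy
        simpa using hcomplete w y hw hy.2 hy.1.symm
    have h1 := Finset.card_le_card hsub
    rw [Finset.card_insert_of_notMem (by simp [hv]), Finset.card_erase_of_mem (by simpa using hw),
      Finset.card_compl, hDcard, Fintype.card_fin] at h1
    have h2 := hDeg x hx
    rw [hdeg_eq] at h2
    rw [Fintype.card_fin]
    have h3 : n ≤ (Finset.univ.filter (G.Adj w)).card + (Finset.univ.filter (G.Adj x)).card := by
      omega
    convert h3
  let B := Dᶜ.filter fun w => ∀ v ∈ D, G.Adj w v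
  have hBmem : ∀ w, w ∈ B ↔ w ∉ D ∧ ∀ v ∈ D, G.Adj w v := fun w => by simp [B]
  have hBD : Disjoint B D := Finset.disjoint_left.2 fun x hx => ((hBmem x).1 hx).1
  have hsplit : ∀ v ∈ D, B.card + (D.filter (G.Adj v)).card = d := by
    intro v hv
    rw [← hDeg v hv, hdeg_eq,
      ← Finset.card_union_of_disjoint (hBD.mono_right (Finset.filter_subset _ _))]
    congr 1
    ext x
    simp only [Finset.mem_union, hBmem, Finset.mem_filter, Finset.mem_univ, true_and]
    constructor
    · rintro (h | h)
      · exact (h.2 v hv).symm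
      · exact h.2
    · intro h
      by_cases hx : x ∈ D
      · exact Or.inr ⟨hx, h⟩
      · exact Or.inl ⟨hx, hall x v hx hv h.symm⟩
  have hcross : ∀ x y, x ∉ D → y ∈ D → (G.Adj x y ↔ x ∈ B) := fun x y hx hy =>
    ⟨fun h => (hBmem x).2 ⟨hx, hall x y hx hy h⟩, fun h => ((hBmem x).1 h).2 y hy⟩
  have hinner : ∀ v ∈ D, D.filter (G.Adj v) ⊆ D.erase v := fun v hv x hx => by
    rw [Finset.mem_filter] at hx
    exact Finset.mem_erase.2 ⟨hx.2.ne', hx.1⟩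
  obtain ⟨v₀, hv₀⟩ : D.Nonempty := Finset.card_pos.1 (by omega)
  have hBpos : 1 ≤ B.card := by
    have h1 := Finset.card_le_card (hinner v₀ hv₀)
    rw [Finset.card_erase_of_mem hv₀] at h1
    have h2 := hsplit v₀ hv₀
    omega
  have hBle : B.card ≤ d := by
    have := hsplit v₀ hv₀
    omega
  rcases hBle.eq_or_lt with hBd | hBd
  · left
    refine nonempty_iso_Hnd (by omega) hBD hDcard hBd fun x y => ?_
    have hind : ∀ x ∈ D, ∀ y ∈ D, ¬ G.Adj x y := by
      intro x hx y hy h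
      have h1 := hsplit x hx
      have h2 : 0 < (D.filter (G.Adj x)).card :=
        Finset.card_pos.2 ⟨y, Finset.mem_filter.2 ⟨hy, h⟩⟩
      omega
    have hBx := fun x (hx : x ∈ B) => ((hBmem x).1 hx).1
    have hc := hcomplete x y
    have hxy := hcross x y
    have hyx := hcross y x
    have hne : G.Adj x y → x ≠ y := fun h => h.ne
    have hs := G.adj_comm x y
    have hi := hind x
    grind
  rcases hBpos.eq_or_lt with hB1 | hB1
  · right
    obtain ⟨w, hw⟩ := Finset.card_eq_one.1 hB1.symm
    have hwD : w ∉ D := ((hBmem w).1 (by simp [hw])).1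
    refine nonempty_iso_Knd' (by omega) hwD hDcard fun x y => ?_
    have hfull : ∀ x ∈ D, ∀ y ∈ D, x ≠ y → G.Adj x y := by
      intro x hx y hy hxy
      have h1 := hsplit x hx
      have h2 := Finset.eq_of_subset_of_card_le (hinner x hx)
        (by rw [Finset.card_erase_of_mem hx]; omega)
      have h3 : y ∈ D.filter (G.Adj x) := h2 ▸ Finset.mem_erase.2 ⟨hxy.symm, hy⟩
      exact (Finset.mem_filter.1 h3).2
    have hBx : ∀ x, x ∈ B ↔ x = w := by simp [hw]
    have hc := hcomplete x y
    have hxy := hcross x y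
    have hyx := hcross y x
    have hne : G.Adj x y → x ≠ y := fun h => h.ne
    have hs := G.adj_comm x y
    have hi := hfull x
    grind
  · exfalso
    obtain ⟨l, hl⟩ := SimpleGraph.exists_isHamiltonianList_of_compl_clique hBD.symm hB1
      (by omega) hcomplete (fun u hu => ((hBmem u).1 hu).2) (fun v hv => by
        have h := (hDcard.trans (hsplit v hv).symm).le
        exact h.trans_eq (by congr))
    exact hG.1 (hl.isHamiltonian hV)
end

section
/- For every graph F on t ≥ 3 vertices, every d ≥ 1, and every n ≥ 4dt + 3d² + 5t, if G is an n-vertex nonhamiltonian graph with minimum degree δ(G) ≥ d, then the number of labeled copies of F in G is at most the number of labeled copies of F in H_{n,d}. -/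
/-- The number of labeled copies of `F` in `G`: injections of vertex sets mapping
edges of `F` to edges of `G`. -/
noncomputable def labeledCopies {α β : Type*} [Fintype α] [Fintype β]
    (G : SimpleGraph β) (F : SimpleGraph α) : ℕ :=
  Nat.card {φ : α ↪ β // ∀ x y, F.Adj x y → G.Adj (φ x) (φ y)}

open Finset

section Hamiltonicity

variable {V : Type*}

/-- A cyclic list of vertices passing through every vertex exactly once, with consecutive
vertices adjacent. -/
def HasSpanningCycle (G : SimpleGraph V) : Prop :=
  ∃ a l, (a :: l : List V).Nodup ∧ (∀ v, v ∈ a :: l) ∧ (a :: (l ++ [a])).IsChain G.Adj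

lemma exists_walk_of_isChain {G : SimpleGraph V} {L : List V} (hne : L ≠ [])
    (hch : L.IsChain G.Adj) {a b : V} (ha : L.head hne = a) (hb : L.getLast hne = b) :
    ∃ p : G.Walk a b, p.support = L := by
  subst ha hb
  exact ⟨.ofSupport L hne hch, SimpleGraph.Walk.support_ofSupport hne hch⟩

lemma HasSpanningCycle.isHamiltonian [Fintype V] [DecidableEq V] {G : SimpleGraph V}
    (h : HasSpanningCycle G) (hV : 3 ≤ Fintype.card V) : G.IsHamiltonian := by
  obtain ⟨a, l, hnd, hmem, hch⟩ := h
  intro _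
  have hlen : (a :: l).length = Fintype.card V := by
    have h1 : (a :: l).toFinset = univ := by ext v; simpa using hmem v
    rw [← List.toFinset_card_of_nodup hnd, h1, card_univ]
  obtain ⟨b, l', rfl⟩ : ∃ b l', l = b :: l' := by
    cases l with
    | nil => simp at hlen; omega
    | cons b l' => exact ⟨b, l', rfl⟩
  have hch' : (b :: (l' ++ [a])).IsChain G.Adj := hch.tail
  have hab : G.Adj a b := by
    have := hch
    simp only [List.cons_append, List.isChain_cons_cons] at this
    exact this.1
  obtain ⟨p, hp⟩ : ∃ p : G.Walk b a, p.support = b :: (l' ++ [a]) :=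
    exists_walk_of_isChain (List.cons_ne_nil _ _) hch' rfl (by simp)
  have hpl : p.length + 1 = (b :: (l' ++ [a])).length := by
    rw [← hp, SimpleGraph.Walk.length_support]
  have hpath : p.IsPath := by
    rw [SimpleGraph.Walk.isPath_def, hp]
    have : (a :: b :: l').Perm (b :: (l' ++ [a])) := by
      rw [← List.cons_append]
      exact (List.perm_append_singleton a (b :: l')).symm
    exact this.nodup_iff.1 hnd
  refine ⟨a, .cons hab p, ?_⟩
  rw [SimpleGraph.Walk.isHamiltonianCycle_iff_isCycle_and_length_eq]
  simp only [List.length_cons, List.length_append, List.length_nil] at hlen hpl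
  refine ⟨?_, by simp; omega⟩
  rw [SimpleGraph.Walk.isCycle_iff_isPath_tail_and_le_length]
  refine ⟨by simpa using hpath, by simp; omega⟩

lemma HasSpanningCycle.exists_cons {G : SimpleGraph V} (h : HasSpanningCycle G) (u : V) :
    ∃ l, (u :: l : List V).Nodup ∧ (∀ v, v ∈ u :: l) ∧ (u :: (l ++ [u])).IsChain G.Adj := by
  obtain ⟨a, l, hnd, hmem, hch⟩ := h
  obtain ⟨s, t, hst⟩ := List.append_of_mem (hmem u)
  have hrot : ((a :: l : List V) : Cycle V) = ((u :: (t ++ s) : List V) : Cycle V) := by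
    rw [hst, Cycle.coe_eq_coe]
    exact ⟨s.length, by simp⟩
  have hperm : (a :: l).Perm (u :: (t ++ s)) := (Cycle.coe_eq_coe.1 hrot).perm
  refine ⟨t ++ s, hperm.nodup_iff.1 hnd, fun v => hperm.mem_iff.1 (hmem v), ?_⟩
  rw [← Cycle.chain_coe_cons, ← hrot, Cycle.chain_coe_cons]
  exact hch

lemma hasSpanningCycle_top [Fintype V] (hV : 2 ≤ Fintype.card V) :
    HasSpanningCycle (⊤ : SimpleGraph V) := by
  classical
  have hnd := nodup_toList (univ : Finset V)
  have hmem : ∀ v, v ∈ (univ : Finset V).toList := by simp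
  have hlen : (univ : Finset V).toList.length = Fintype.card V := by simp
  match hl : (univ : Finset V).toList with
  | [] => simp [hl] at hlen; omega
  | [_] => simp [hl] at hlen; omega
  | a :: b :: l =>
    rw [hl] at hnd hmem
    refine ⟨a, b :: l, hnd, hmem, ?_⟩
    rw [← List.cons_append, List.isChain_append]
    refine ⟨List.Pairwise.isChain (hnd.imp fun h => h), by simp, ?_⟩
    intro x hx y hy
    simp only [List.head?_cons, Option.mem_some_iff] at hy
    subst hy
    rw [SimpleGraph.top_adj]
    rintro rfl
    rw [List.getLast?_cons_cons] at hx
    exact (List.nodup_cons.1 hnd).1 (List.mem_of_mem_getLast? hx)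

/-- Closing a spanning path `u … y x … v` with `u ~ x` and `v ~ y` to a spanning cycle. -/
lemma hasSpanningCycle_of_crossing {G : SimpleGraph V} {s t : List V} {u v x y : V}
    (hnd : (s ++ y :: x :: t).Nodup) (hmem : ∀ w, w ∈ s ++ y :: x :: t)
    (hch : (s ++ y :: x :: t).IsChain G.Adj) (hu : (s ++ y :: x :: t).head? = some u)
    (hv : (s ++ y :: x :: t).getLast? = some v) (hux : G.Adj u x) (hvy : G.Adj v y) :
    HasSpanningCycle G := by
  have hsplit : s ++ y :: x :: t = (s ++ [y]) ++ x :: t := by simp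
  obtain ⟨s', hs'⟩ : ∃ s', s ++ [y] = u :: s' := by
    cases s with
    | nil => simp at hu; subst hu; exact ⟨[], rfl⟩
    | cons a s => simp at hu; subst hu; exact ⟨s ++ [y], rfl⟩
  have hlast : (s ++ [y]).getLast? = some y := by simp
  have hv' : (x :: t).getLast? = some v := by
    rw [hsplit, List.getLast?_append_of_ne_nil _ (by simp)] at hv
    exact hv
  rw [hsplit] at hch hnd hmem
  rw [hs'] at hlast hch hnd hmem
  have hperm : (u :: s' ++ x :: t).Perm (u :: (s' ++ (x :: t).reverse)) :=
    List.Perm.append_left (u :: s') (List.reverse_perm (x :: t)).symm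
  refine ⟨u, s' ++ (x :: t).reverse, hperm.nodup_iff.1 hnd,
    fun w => hperm.mem_iff.1 (hmem w), ?_⟩
  rw [List.isChain_append] at hch
  rw [show u :: (s' ++ (x :: t).reverse ++ [u]) = (u :: s') ++ ((x :: t).reverse ++ [u]) by simp,
    List.isChain_append, List.isChain_append]
  refine ⟨hch.1, ⟨?_, by simp, ?_⟩, ?_⟩
  · rw [List.isChain_reverse]
    exact hch.2.1.imp fun _ _ h => h.symm
  · intro p hp q hq
    simp at hp hq
    subst hp hq
    exact hux.symm
  · intro p hp q hq
    rw [hlast] at hp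
    have : ((x :: t).reverse ++ [u]).head? = some v := by
      rw [List.head?_append_of_ne_nil _ (by simp), List.head?_reverse, hv']
    rw [this] at hq
    simp at hp hq
    subst hp hq
    exact hvy.symm

/-- Ore's argument: in a graph without spanning cycle, the end vertices of a spanning path have
degree sum less than the number of vertices. -/
lemma degree_add_degree_lt_of_spanning_path [Fintype V] {G : SimpleGraph V}
    [DecidableRel G.Adj] (hG : ¬ HasSpanningCycle G) {P : List V} {u v : V} (hnd : P.Nodup)
    (hmem : ∀ w, w ∈ P) (hch : P.IsChain G.Adj) (hu : P.head? = some u)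
    (hv : P.getLast? = some v) : G.degree u + G.degree v < Fintype.card V := by
  classical
  have hlen : P.length = Fintype.card V := by
    have h1 : P.toFinset = univ := by ext v; simpa using hmem v
    rw [← List.toFinset_card_of_nodup hnd, h1, card_univ]
  have hpos : 0 < P.length := List.length_pos_of_mem (hmem u)
  have hidx : ∀ w, P.idxOf w < P.length := fun w => List.idxOf_lt_length_of_mem (hmem w)
  have hget : ∀ w, P[P.idxOf w]'(hidx w) = w := fun w => List.getElem_idxOf (hidx w)
  have hinj : ∀ {w w'}, P.idxOf w = P.idxOf w' → w = w' := by
    intro w w' h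
    rw [← hget w, ← hget w']
    simp only [h]
  have hu0 : ∀ w, w ≠ u → 0 < P.idxOf w := by
    intro w hw
    by_contra h
    apply hw
    rw [List.head?_eq_getElem?, List.getElem?_eq_getElem hpos] at hu
    rw [← hget w]
    simp only [show P.idxOf w = 0 by omega]
    simpa using hu
  have hvl : ∀ w, w ≠ v → P.idxOf w < P.length - 1 := by
    intro w hw
    by_contra h
    apply hw
    have h2 := hidx w
    rw [List.getLast?_eq_getElem?, List.getElem?_eq_getElem (by omega)] at hv
    rw [← hget w]
    simp only [show P.idxOf w = P.length - 1 by omega]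
    simpa using hv
  let I := (G.neighborFinset u).image fun w => P.idxOf w - 1
  let J := (G.neighborFinset v).image fun w => P.idxOf w
  have hI : I.card = G.degree u := by
    refine card_image_of_injOn ?_
    intro w hw w' hw' h
    have h1 := hu0 w (by simpa using (by simpa using hw : G.Adj u w).ne')
    have h2 := hu0 w' (by simpa using (by simpa using hw' : G.Adj u w').ne')
    apply hinj
    simp only at h
    omega
  have hJ : J.card = G.degree v := card_image_of_injOn fun w _ w' _ h => hinj h
  have hdisj : Disjoint I J := by
    rw [Finset.disjoint_left]
    intro i hi hj
    simp only [I, J, mem_image, SimpleGraph.mem_neighborFinset] at hi hj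
    obtain ⟨x, hx, hxi⟩ := hi
    obtain ⟨y, hy, hyi⟩ := hj
    have hx0 := hu0 x hx.ne'
    have hxi' : i + 1 < P.length := by have := hidx x; omega
    have hPx : P[i + 1] = x := by
      rw [← hget x]; simp only [show P.idxOf x = i + 1 by omega]
    have hPy : P[i] = y := by
      have := hget y
      simpa only [hyi] using this
    have hP : P = P.take i ++ y :: x :: P.drop (i + 2) := by
      conv_lhs => rw [← List.take_append_drop i P, List.drop_eq_getElem_cons (by omega),
        List.drop_eq_getElem_cons hxi', hPx, hPy]
    rw [hP] at hnd hmem hch hu hv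
    exact hG (hasSpanningCycle_of_crossing hnd hmem hch hu hv hx hy)
  have hsub : I ∪ J ⊆ range (P.length - 1) := by
    intro i hi
    simp only [I, J, mem_union, mem_image, SimpleGraph.mem_neighborFinset] at hi
    rw [mem_range]
    rcases hi with ⟨x, hx, rfl⟩ | ⟨y, hy, rfl⟩
    · have := hu0 x hx.ne'
      have := hidx x
      omega
    · exact hvl y hy.ne'
  have := card_le_card hsub
  rw [card_union_of_disjoint hdisj, hI, hJ, card_range] at this
  omega

/-- In an edge-maximal graph without spanning cycle, nonadjacent vertices are joined by a
spanning path. -/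
lemma exists_spanning_path_of_maximal [Fintype V] (hV : 3 ≤ Fintype.card V)
    {G : SimpleGraph V} (hG : Maximal (fun H => ¬ HasSpanningCycle H) G) {u v : V}
    (huv : u ≠ v) (hadj : ¬ G.Adj u v) :
    ∃ P : List V, P.Nodup ∧ (∀ w, w ∈ P) ∧ P.IsChain G.Adj ∧ P.head? = some u ∧
      P.getLast? = some v := by
  classical
  have hH : HasSpanningCycle (G ⊔ SimpleGraph.edge u v) := by
    by_contra h
    have := hG.2 h le_sup_left
    exact hadj (this (by simp [SimpleGraph.edge_adj, huv]))
  obtain ⟨l, hnd, hmem, hch⟩ := hH.exists_cons u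
  have hul : u ∉ l := (List.nodup_cons.1 hnd).1
  have hlnd : l.Nodup := (List.nodup_cons.1 hnd).2
  have hlen : (u :: l).length = Fintype.card V := by
    have h1 : (u :: l).toFinset = univ := by ext v; simpa using hmem v
    rw [← List.toFinset_card_of_nodup hnd, h1, card_univ]
  have hne : l ≠ [] := by rintro rfl; simp at hlen; omega
  have hch1 := (List.isChain_cons.1 hch)
  have hch2 := List.isChain_append.1 hch1.2
  obtain ⟨b, hb⟩ : ∃ b, l.head? = some b := ⟨_, List.head?_eq_some_head hne⟩
  obtain ⟨c, hc⟩ : ∃ c, l.getLast? = some c := ⟨_, List.getLast?_eq_some_getLast hne⟩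
  have hbl : b ∈ l := List.mem_of_mem_head? hb
  have hcl : c ∈ l := List.mem_of_mem_getLast? hc
  have hub : (G ⊔ SimpleGraph.edge u v).Adj u b := by
    apply hch1.1
    rw [List.head?_append_of_ne_nil _ hne, hb]; simp
  have hcu : (G ⊔ SimpleGraph.edge u v).Adj c u := by
    apply hch2.2.2 c (by simp [hc]) u (by simp)
  have hlG : l.IsChain G.Adj := by
    have := hch2.1
    rw [List.isChain_iff_getElem] at this ⊢
    intro i hi
    have h1 := this i hi
    have e1 : l[i] ≠ u := fun h => hul (h ▸ List.getElem_mem _)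
    have e2 : l[i + 1] ≠ u := fun h => hul (h ▸ List.getElem_mem _)
    simp only [SimpleGraph.sup_adj, SimpleGraph.edge_adj] at h1
    tauto
  have hbc : b ≠ c := by
    rintro rfl
    match l, hne with
    | [a], _ => simp at hlen; omega
    | a :: a' :: l', _ =>
      simp at hb
      subst hb
      rw [List.getLast?_cons_cons] at hc
      exact (List.nodup_cons.1 hlnd).1 (List.mem_of_mem_getLast? hc)
  by_cases hbv : b = v
  · subst hbv
    have hcu' : G.Adj c u := by
      simp only [SimpleGraph.sup_adj, SimpleGraph.edge_adj] at hcu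
      have := hbc.symm
      have : c ≠ u := fun h => hul (h ▸ hcl)
      tauto
    have hperm : (u :: l).Perm (u :: l.reverse) := (List.reverse_perm l).symm.cons u
    refine ⟨u :: l.reverse, hperm.nodup_iff.1 hnd, fun w => hperm.mem_iff.1 (hmem w), ?_, rfl, ?_⟩
    · rw [List.isChain_cons]
      refine ⟨?_, ?_⟩
      · intro y hy
        rw [List.head?_reverse, hc] at hy
        simp at hy
        exact hy ▸ hcu'.symm
      · rw [List.isChain_reverse]
        exact hlG.imp fun _ _ h => h.symm
    · rw [← List.singleton_append, List.getLast?_append_of_ne_nil _ (by simpa using hne),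
        List.getLast?_reverse, hb]
  · have hub' : G.Adj u b := by
      simp only [SimpleGraph.sup_adj, SimpleGraph.edge_adj] at hub
      tauto
    have hpath : (u :: l).IsChain G.Adj := by
      rw [List.isChain_cons]
      refine ⟨?_, hlG⟩
      intro y hy
      rw [hb] at hy
      simp at hy
      exact hy ▸ hub'
    have hlast : (u :: l).getLast? = some c := by
      rw [← List.singleton_append, List.getLast?_append_of_ne_nil _ hne, hc]
    by_cases hcv : c = v
    · exact ⟨u :: l, hnd, hmem, hpath, rfl, hcv ▸ hlast⟩
    · exfalso
      apply hG.1
      refine ⟨u, l, hnd, hmem, ?_⟩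
      rw [← List.cons_append, List.isChain_append]
      refine ⟨hpath, by simp, ?_⟩
      intro x hx y hy
      rw [hlast] at hx
      simp at hx hy
      subst hx hy
      simp only [SimpleGraph.sup_adj, SimpleGraph.edge_adj] at hcu
      tauto

lemma degree_add_degree_lt_of_maximal [Fintype V] (hV : 3 ≤ Fintype.card V)
    {G : SimpleGraph V} [DecidableRel G.Adj] (hG : Maximal (fun H => ¬ HasSpanningCycle H) G)
    {u v : V} (huv : u ≠ v) (hadj : ¬ G.Adj u v) :
    G.degree u + G.degree v < Fintype.card V := by
  obtain ⟨P, h1, h2, h3, h4, h5⟩ := exists_spanning_path_of_maximal hV hG huv hadj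
  exact degree_add_degree_lt_of_spanning_path hG.1 h1 h2 h3 h4 h5

end Hamiltonicity

section DegreeSequence

variable {V : Type*} [Fintype V]

/-- Pósa's threshold: if nonadjacent vertices have degree sum less than `|V|`, then for some `r`
below `|V| / 2` there are at least `r` vertices of degree at most `r` and the remaining vertices
form a clique, and `r` is the largest number with the first property. -/
lemma exists_degree_threshold {G : SimpleGraph V} [DecidableRel G.Adj] [Nonempty V]
    (hore : ∀ u v, u ≠ v → ¬ G.Adj u v → G.degree u + G.degree v < Fintype.card V) :
    ∃ r, 2 * r < Fintype.card V ∧ r ≤ #{v | G.degree v ≤ r} ∧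
      (∀ q, r < q → 2 * q < Fintype.card V → #{v | G.degree v ≤ q} < q) ∧
      ∀ x y, x ≠ y → r < G.degree x → r < G.degree y → G.Adj x y := by
  classical
  let R := (range (Fintype.card V)).filter fun q =>
    2 * q < Fintype.card V ∧ q ≤ #{v | G.degree v ≤ q}
  have hmemR : ∀ q, q ∈ R ↔ 2 * q < Fintype.card V ∧ q ≤ #{v | G.degree v ≤ q} := by
    intro q
    simp only [R, mem_filter, mem_range]
    refine ⟨fun h => h.2, fun h => ⟨by omega, h⟩⟩
  have hR : R.Nonempty := ⟨0, (hmemR 0).2 ⟨by simpa using Fintype.card_pos, by simp⟩⟩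
  obtain ⟨r, hr, hmax⟩ := R.exists_max_image id hR
  have hmax' : ∀ q, r < q → 2 * q < Fintype.card V → #{v | G.degree v ≤ q} < q := by
    intro q hq hq2
    by_contra! h
    have := hmax q ((hmemR q).2 ⟨hq2, h⟩)
    simp only [id] at this
    omega
  obtain ⟨hr1, hr2⟩ := (hmemR r).1 hr
  refine ⟨r, hr1, hr2, hmax', ?_⟩
  by_contra! hcon
  let S := (univ : Finset (V × V)).filter fun p =>
    p.1 ≠ p.2 ∧ r < G.degree p.1 ∧ r < G.degree p.2 ∧ ¬ G.Adj p.1 p.2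
  have hS : S.Nonempty := by
    obtain ⟨x, y, h⟩ := hcon
    exact ⟨(x, y), by simpa [S] using h⟩
  obtain ⟨⟨x, y⟩, hxy, hxymax⟩ := S.exists_max_image (fun p => G.degree p.1 + G.degree p.2) hS
  simp only [S, mem_filter, mem_univ, true_and] at hxy hxymax
  obtain ⟨x, y, hle, hne, hx, hy, hadj, hxymax⟩ : ∃ x y, G.degree x ≤ G.degree y ∧ x ≠ y ∧
      r < G.degree x ∧ r < G.degree y ∧ ¬ G.Adj x y ∧
      ∀ p : V × V, p.1 ≠ p.2 ∧ r < G.degree p.1 ∧ r < G.degree p.2 ∧ ¬ G.Adj p.1 p.2 →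
        G.degree p.1 + G.degree p.2 ≤ G.degree x + G.degree y := by
    rcases le_total (G.degree x) (G.degree y) with h | h
    · exact ⟨x, y, h, hxy.1, hxy.2.1, hxy.2.2.1, hxy.2.2.2, hxymax⟩
    · exact ⟨y, x, h, hxy.1.symm, hxy.2.2.1, hxy.2.1, fun h => hxy.2.2.2 h.symm,
        fun p hp => (hxymax p hp).trans (add_comm _ _).le⟩
  have hsum := hore x y hne hadj
  have hlt := hmax' (G.degree x) hx (by omega)
  have hsub : univ \ insert y (G.neighborFinset y) ⊆
      univ.filter fun v => G.degree v ≤ G.degree x := by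
    intro z hz
    simp only [mem_sdiff, mem_univ, true_and, mem_insert, SimpleGraph.mem_neighborFinset,
      not_or] at hz
    simp only [mem_filter, mem_univ, true_and]
    by_contra! h
    have := hxymax (z, y) ⟨hz.1, by simp only; omega, hy, fun h => hz.2 h.symm⟩
    simp only at this
    omega
  have h1 := card_le_card hsub
  rw [card_sdiff_of_subset (subset_univ _), card_insert_of_notMem (by simp), card_univ,
    SimpleGraph.card_neighborFinset_eq_degree] at h1
  omega

end DegreeSequence

section Counting

variable {α V : Type*} [Fintype α] [Fintype V] [DecidableEq α] [DecidableEq V]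

omit [Fintype α] [Fintype V] [DecidableEq α] [DecidableEq V] in
lemma card_le_card_of_perm {P Q : Finset (α ↪ V)} (σ : Equiv.Perm V)
    (h : ∀ φ ∈ P, φ.trans σ.toEmbedding ∈ Q) : #P ≤ #Q := by
  refine card_le_card_of_injOn (fun φ => φ.trans σ.toEmbedding) h fun φ _ ψ _ h => ?_
  ext x
  simpa using DFunLike.congr_fun h x

omit [DecidableEq α] in
lemma card_mul_card_filter_apply_eq (u : α) (a : V) :
    Fintype.card V * #{φ : α ↪ V | φ u = a} = Fintype.card (α ↪ V) := by
  have h : ∀ b ∈ (univ : Finset V), #{φ : α ↪ V | φ u = b} = #{φ : α ↪ V | φ u = a} := by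
    intro b _
    apply le_antisymm <;>
    · refine card_le_card_of_perm (Equiv.swap a b) fun φ hφ => ?_
      simp only [mem_filter, mem_univ, true_and] at hφ ⊢
      simp [hφ]
  have h1 := card_eq_sum_card_fiberwise (f := fun φ : α ↪ V => φ u) (s := univ)
    (t := univ) (fun _ _ => by simp)
  rw [sum_congr rfl h, sum_const, card_univ, card_univ, smul_eq_mul] at h1
  exact h1.symm

omit [DecidableEq α] in
lemma card_sub_one_mul_card_filter_apply_eq_and {u w : α} (huw : u ≠ w) {a b : V} (hab : a ≠ b) :
    (Fintype.card V - 1) * #{φ : α ↪ V | φ u = a ∧ φ w = b} = #{φ : α ↪ V | φ u = a} := by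
  have h : ∀ c ∈ (univ.erase a : Finset V),
      #{φ : α ↪ V | φ u = a ∧ φ w = c} = #{φ : α ↪ V | φ u = a ∧ φ w = b} := by
    intro c hc
    have hca : c ≠ a := by simpa using hc
    apply le_antisymm <;>
    · refine card_le_card_of_perm (Equiv.swap b c) fun φ hφ => ?_
      simp only [mem_filter, mem_univ, true_and] at hφ ⊢
      simp [hφ, Equiv.swap_apply_of_ne_of_ne hab hca.symm]
  rw [card_eq_sum_card_fiberwise (f := fun φ : α ↪ V => φ w)
    (s := univ.filter fun φ : α ↪ V => φ u = a) (t := univ.erase a) ?_]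
  · simp only [filter_filter]
    rw [sum_congr rfl h]
    simp [card_erase_of_mem, card_univ]
  · intro φ hφ
    simp only [coe_filter, mem_univ, true_and, Set.mem_ofPred_eq] at hφ
    simp only [coe_erase, coe_univ, Set.mem_sdiff, Set.mem_univ, true_and, Set.mem_singleton_iff]
    rw [← hφ]
    exact fun h => huw (φ.injective h.symm)

variable (α V) in
/-- The number of injections `α ↪ V` with two prescribed values. -/
noncomputable def pairCount : ℚ :=
  (Fintype.card (α ↪ V) : ℚ) / (Fintype.card V * (Fintype.card V - 1))

omit [DecidableEq α] [DecidableEq V] in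
variable (α V) in
lemma pairCount_nonneg (hV : 2 ≤ Fintype.card V) : 0 ≤ pairCount α V := by
  have : (2 : ℚ) ≤ Fintype.card V := by exact_mod_cast hV
  exact div_nonneg (by positivity) (mul_nonneg (by positivity) (by linarith))

omit [DecidableEq α] [DecidableEq V] in
variable (α V) in
lemma card_embedding_eq (hV : 2 ≤ Fintype.card V) : (Fintype.card (α ↪ V) : ℚ) =
    Fintype.card V * (Fintype.card V - 1) * pairCount α V := by
  have : (2 : ℚ) ≤ Fintype.card V := by exact_mod_cast hV
  rw [pairCount, mul_div_cancel₀]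
  exact mul_ne_zero (by linarith) (by linarith)

omit [DecidableEq α] in
lemma card_filter_apply_eq (hV : 2 ≤ Fintype.card V) (u : α) (a : V) :
    (#{φ : α ↪ V | φ u = a} : ℚ) = (Fintype.card V - 1) * pairCount α V := by
  have h2 : (2 : ℚ) ≤ Fintype.card V := by exact_mod_cast hV
  have h : (Fintype.card V : ℚ) * #{φ : α ↪ V | φ u = a} = Fintype.card (α ↪ V) := by
    exact_mod_cast card_mul_card_filter_apply_eq u a
  rw [card_embedding_eq α V hV, mul_assoc] at h
  exact mul_left_cancel₀ (by linarith) h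

omit [DecidableEq α] in
lemma card_filter_apply_eq_and (hV : 2 ≤ Fintype.card V) {u w : α} (huw : u ≠ w) {a b : V}
    (hab : a ≠ b) : (#{φ : α ↪ V | φ u = a ∧ φ w = b} : ℚ) = pairCount α V := by
  have h2 : (2 : ℚ) ≤ Fintype.card V := by exact_mod_cast hV
  have h := congrArg (Nat.cast (R := ℚ)) (card_sub_one_mul_card_filter_apply_eq_and huw hab)
  push_cast [Nat.cast_sub (show 1 ≤ Fintype.card V by omega)] at h
  rw [card_filter_apply_eq hV] at h
  exact mul_left_cancel₀ (by linarith) h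

omit [DecidableEq α] in
/-- First moment: the number of elements of `M` mapped into `B`, summed over all injections. -/
lemma sum_card_filter_mem (hV : 2 ≤ Fintype.card V) (M : Finset α) (B : Finset V) :
    ∑ φ : α ↪ V, (#{u ∈ M | φ u ∈ B} : ℚ) =
      #M * #B * (Fintype.card V - 1) * pairCount α V := by
  have h : ∀ φ : α ↪ V, (#{u ∈ M | φ u ∈ B} : ℚ) =
      ∑ u ∈ M, ∑ a ∈ B, if φ u = a then 1 else 0 := by
    intro φ
    simp
  simp_rw [h]
  rw [sum_comm]
  simp_rw [sum_comm (s := univ)]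
  have h' : ∀ u ∈ M, ∀ a ∈ B, ∑ φ : α ↪ V, (if φ u = a then (1 : ℚ) else 0) =
      (Fintype.card V - 1) * pairCount α V := by
    intro u _ a _
    rw [← card_filter_apply_eq hV u a]
    simp
  rw [sum_congr rfl fun u hu => sum_congr rfl (h' u hu)]
  simp only [sum_const, nsmul_eq_mul]
  ring

/-- Second moment: for `A ⊆ B`, the number of ordered pairs of distinct elements of `M` with the
first mapped into `A` and the second mapped into `B`, summed over all injections. -/
lemma sum_card_filter_mem_mul (hV : 2 ≤ Fintype.card V) (M : Finset α) {A B : Finset V}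
    (hAB : A ⊆ B) :
    ∑ φ : α ↪ V, (#{u ∈ M | φ u ∈ A} : ℚ) * (#{u ∈ M | φ u ∈ B} - 1) =
      #M * (#M - 1) * #A * (#B - 1) * pairCount α V := by
  have h : ∀ φ : α ↪ V, (#{u ∈ M | φ u ∈ A} : ℚ) * (#{u ∈ M | φ u ∈ B} - 1) =
      ∑ u ∈ M, ∑ w ∈ M.erase u, ∑ a ∈ A, ∑ b ∈ B.erase a,
        if φ u = a ∧ φ w = b then 1 else 0 := by
    intro φ
    have h1 : ∀ u ∈ M, ∑ w ∈ M.erase u, ∑ a ∈ A, ∑ b ∈ B.erase a,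
        (if φ u = a ∧ φ w = b then (1 : ℚ) else 0) =
        if φ u ∈ A then (#{u ∈ M | φ u ∈ B} - 1 : ℚ) else 0 := by
      intro u hu
      by_cases hA : φ u ∈ A
      · rw [if_pos hA]
        have h2 : ∀ w ∈ M.erase u, ∑ a ∈ A, ∑ b ∈ B.erase a,
            (if φ u = a ∧ φ w = b then (1 : ℚ) else 0) = if φ w ∈ B then 1 else 0 := by
          intro w hw
          have hwu : φ w ≠ φ u := fun h => (mem_erase.1 hw).1 (φ.injective h)
          rw [sum_eq_single_of_mem (φ u) hA]
          · simp [hwu, sum_ite_eq]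
          · intro a _ ha
            exact sum_eq_zero fun b _ => by simp [ha.symm]
        rw [sum_congr rfl h2, ← sum_filter, sum_const, nsmul_eq_mul, mul_one]
        have h3 : (M.erase u).filter (fun w => φ w ∈ B) = (M.filter fun w => φ w ∈ B).erase u := by
          ext w; simp [and_assoc]
        have h4 : u ∈ M.filter fun w => φ w ∈ B := mem_filter.2 ⟨hu, hAB hA⟩
        rw [h3, ← card_erase_add_one h4]
        push_cast
        ring
      · rw [if_neg hA]
        refine sum_eq_zero fun w _ => sum_eq_zero fun a ha => sum_eq_zero fun b _ => ?_
        rw [if_neg]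
        rintro ⟨rfl, _⟩
        exact hA ha
    rw [sum_congr rfl h1, ← sum_filter, sum_const, nsmul_eq_mul]
  simp_rw [h]
  rw [sum_comm]
  have h' : ∀ u ∈ M, ∑ φ : α ↪ V, ∑ w ∈ M.erase u, ∑ a ∈ A, ∑ b ∈ B.erase a,
      (if φ u = a ∧ φ w = b then (1 : ℚ) else 0) =
      (#M - 1) * (#A * ((#B - 1) * pairCount α V)) := by
    intro u hu
    rw [sum_comm]
    have h1 : ∀ w ∈ M.erase u, ∑ φ : α ↪ V, ∑ a ∈ A, ∑ b ∈ B.erase a,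
        (if φ u = a ∧ φ w = b then (1 : ℚ) else 0) = #A * ((#B - 1) * pairCount α V) := by
      intro w hw
      have huw : u ≠ w := (mem_erase.1 hw).1.symm
      rw [sum_comm]
      have h2 : ∀ a ∈ A, ∑ φ : α ↪ V, ∑ b ∈ B.erase a,
          (if φ u = a ∧ φ w = b then (1 : ℚ) else 0) = (#B - 1) * pairCount α V := by
        intro a ha
        rw [sum_comm]
        have h3 : ∀ b ∈ B.erase a, ∑ φ : α ↪ V,
            (if φ u = a ∧ φ w = b then (1 : ℚ) else 0) = pairCount α V := by
          intro b hb
          rw [← card_filter_apply_eq_and hV huw (mem_erase.1 hb).1.symm]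
          simp
        rw [sum_congr rfl h3, sum_const, nsmul_eq_mul, ← card_erase_add_one (hAB ha)]
        push_cast
        ring
      rw [sum_congr rfl h2, sum_const, nsmul_eq_mul]
    rw [sum_congr rfl h1, sum_const, nsmul_eq_mul, ← card_erase_add_one hu]
    push_cast
    ring
  rw [sum_congr rfl h', sum_const, nsmul_eq_mul]
  ring

end Counting

section Comparison

variable {V : Type*} [Fintype V] [DecidableEq V]

lemma exists_perm_mem_iff {C D C' D' : Finset V} (hCD : Disjoint C D) (hCD' : Disjoint C' D')
    (hC : #C = #C') (hD : #D = #D') :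
    ∃ σ : Equiv.Perm V, (∀ x, σ x ∈ C' ↔ x ∈ C) ∧ ∀ x, σ x ∈ D' ↔ x ∈ D := by
  let e := Finset.equivOfCardEq hC
  let e' := Finset.equivOfCardEq hD
  let f : V → V := fun x => if h : x ∈ C then e ⟨x, h⟩ else if h : x ∈ D then e' ⟨x, h⟩ else x
  have hfC : ∀ x (h : x ∈ C), f x = e ⟨x, h⟩ := fun x h => by simp [f, h]
  have hfD : ∀ x (h : x ∈ D), f x = e' ⟨x, h⟩ := fun x h => by
    simp [f, h, disjoint_right.1 hCD h]
  have hmC : ∀ x ∈ C, f x ∈ C' := fun x h => by rw [hfC x h]; exact (e _).2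
  have hmD : ∀ x ∈ D, f x ∈ D' := fun x h => by rw [hfD x h]; exact (e' _).2
  have hinjC : Set.InjOn f C := fun x hx y hy h => by
    rw [hfC x hx, hfC y hy, Subtype.coe_inj] at h
    simpa using e.injective h
  have hinjD : Set.InjOn f D := fun x hx y hy h => by
    rw [hfD x hx, hfD y hy, Subtype.coe_inj] at h
    simpa using e'.injective h
  have hinj : Set.InjOn f (C ∪ D : Finset V) := by
    intro x hx y hy h
    rw [mem_coe, mem_union] at hx hy
    rcases hx with hx | hx <;> rcases hy with hy | hy
    · exact hinjC hx hy h
    · exact absurd (h ▸ hmC x hx) (disjoint_right.1 hCD' (hmD y hy))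
    · exact absurd (h ▸ hmD x hx) (disjoint_left.1 hCD' (hmC y hy))
    · exact hinjD hx hy h
  obtain ⟨g, hg⟩ := Finset.exists_equiv_extend_of_card_eq (t := (univ : Finset V))
    (by simp) (subset_univ _) hinj
  let σ : Equiv.Perm V := g.trans (Equiv.subtypeUnivEquiv fun x => mem_univ x)
  have hσ : ∀ x ∈ C ∪ D, σ x = f x := hg
  have himC : C.image σ = C' := by
    refine eq_of_subset_of_card_le (image_subset_iff.2 fun x hx => ?_) ?_
    · rw [hσ x (mem_union_left _ hx)]
      exact hmC x hx
    · rw [card_image_of_injective _ σ.injective, hC]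
  have himD : D.image σ = D' := by
    refine eq_of_subset_of_card_le (image_subset_iff.2 fun x hx => ?_) ?_
    · rw [hσ x (mem_union_right _ hx)]
      exact hmD x hx
    · rw [card_image_of_injective _ σ.injective, hD]
  refine ⟨σ, fun x => ?_, fun x => ?_⟩
  · rw [← himC]; simp
  · rw [← himD]; simp

omit [DecidableEq V] in
lemma labeledCopies_eq_card_filter {α : Type*} [Fintype α] (G : SimpleGraph V)
    (F : SimpleGraph α) [DecidablePred fun φ : α ↪ V => ∀ x y, F.Adj x y → G.Adj (φ x) (φ y)] :
    labeledCopies G F = #{φ : α ↪ V | ∀ x y, F.Adj x y → G.Adj (φ x) (φ y)} := by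
  rw [labeledCopies, Nat.card_eq_fintype_card, Fintype.card_subtype]

/-- Up to isomorphism, the embeddings of `F` into `Hnd n d` are those for which no edge is mapped
inside `D`, and edges meeting `D` are mapped between `D` and `C`. -/
lemma card_le_labeledCopies_Hnd {n d : ℕ} {α : Type*} [Fintype α] (h2d : 2 * d ≤ n)
    (F : SimpleGraph α) {C D : Finset (Fin n)} (hCD : Disjoint C D) (hC : #C = d) (hD : #D = d)
    (P : Finset (α ↪ Fin n))
    (hP : ∀ φ ∈ P, ∀ x y, F.Adj x y →
      (φ x ∉ D ∧ φ y ∉ D) ∨ (φ x ∈ D ∧ φ y ∈ C) ∨ (φ x ∈ C ∧ φ y ∈ D)) :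
    #P ≤ labeledCopies (Hnd n d) F := by
  classical
  let C' : Finset (Fin n) := {x | x.val < d}
  let D' : Finset (Fin n) := {x | n - d ≤ x.val}
  have hdisj : Disjoint C' D' := by
    rw [disjoint_left]
    intro x hx hx'
    simp only [C', D', mem_filter, mem_univ, true_and] at hx hx'
    omega
  have hC' : #C' = d := by
    rw [Fin.card_filter_val_lt]
    omega
  have hD' : #D' = d := by
    have h1 := card_filter_add_card_filter_not (s := (univ : Finset (Fin n)))
      (fun x => x.val < n - d)
    simp only [not_lt, Fin.card_filter_val_lt, card_univ, Fintype.card_fin] at h1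
    change #D' = d
    simp only [D']
    omega
  obtain ⟨σ, hσC, hσD⟩ := exists_perm_mem_iff hCD hdisj (hC.trans hC'.symm) (hD.trans hD'.symm)
  rw [labeledCopies_eq_card_filter]
  refine card_le_card_of_perm σ fun φ hφ => ?_
  rw [mem_filter]
  refine ⟨mem_univ _, fun x y hxy => ?_⟩
  have hne : σ (φ x) ≠ σ (φ y) := by
    simpa using hxy.ne
  simp only [C', D', mem_filter, mem_univ, true_and] at hσC hσD
  have := hP φ hφ x y hxy
  rw [← hσD, ← hσD, ← hσC, ← hσC] at this
  simp only [Function.Embedding.trans_apply, Equiv.coe_toEmbedding, Hnd, SimpleGraph.fromRel_adj]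
  refine ⟨hne, ?_⟩
  omega

end Comparison

section Avoidance

variable {α V : Type*} [Fintype α] [Fintype V] [DecidableEq α] [DecidableEq V]

lemma card_filter_forall_notMem_eq_sum (M : Finset α) (B : Finset V) :
    (#{φ : α ↪ V | ∀ u ∈ M, φ u ∉ B} : ℚ) =
      ∑ φ : α ↪ V, if #{u ∈ M | φ u ∈ B} = 0 then (1 : ℚ) else 0 := by
  rw [sum_boole]
  simp [card_eq_zero, filter_eq_empty_iff]

/-- Bonferroni upper bound for the number of injections mapping no element of `M` into `B`. -/
lemma card_filter_forall_notMem_le (hV : 2 ≤ Fintype.card V) (M : Finset α) (B : Finset V) :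
    (#{φ : α ↪ V | ∀ u ∈ M, φ u ∉ B} : ℚ) ≤ Fintype.card (α ↪ V) -
      #M * #B * (Fintype.card V - 1) * pairCount α V +
      #M * (#M - 1) * #B * (#B - 1) * pairCount α V / 2 := by
  rw [card_filter_forall_notMem_eq_sum, ← sum_card_filter_mem hV,
    ← sum_card_filter_mem_mul hV M (Subset.refl B), sum_div, Fintype.card,
    card_eq_sum_ones, Nat.cast_sum, ← sum_sub_distrib, ← sum_add_distrib]
  refine sum_le_sum fun φ _ => ?_
  generalize #{u ∈ M | φ u ∈ B} = j
  rcases j with _ | _ | j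
  · simp
  · simp
  · simp only [Nat.add_eq_zero_iff, one_ne_zero, and_false, if_false]
    push_cast
    have : (0 : ℚ) ≤ j := by positivity
    nlinarith

/-- Union lower bound for the number of injections mapping no element of `M` into `B`. -/
lemma le_card_filter_forall_notMem (hV : 2 ≤ Fintype.card V) (M : Finset α) (B : Finset V) :
    Fintype.card (α ↪ V) - #M * #B * (Fintype.card V - 1) * pairCount α V ≤
      (#{φ : α ↪ V | ∀ u ∈ M, φ u ∉ B} : ℚ) := by
  rw [card_filter_forall_notMem_eq_sum, ← sum_card_filter_mem hV, Fintype.card,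
    card_eq_sum_ones, Nat.cast_sum, ← sum_sub_distrib]
  refine sum_le_sum fun φ _ => ?_
  generalize #{u ∈ M | φ u ∈ B} = j
  rcases j with _ | j
  · simp
  · simp

/-- Enlarging `A` to `B` reduces the number of injections mapping no element of `M` into the set
at least by the amount given by the second-order Bonferroni inequality. -/
lemma le_card_filter_forall_notMem_sub (hV : 2 ≤ Fintype.card V) (M : Finset α) {A B : Finset V}
    (hAB : A ⊆ B) :
    #M * (#B - #A) * (Fintype.card V - 1) * pairCount α V -
      #M * (#M - 1) * (#B - #A) * (#B - 1) * pairCount α V ≤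
    (#{φ : α ↪ V | ∀ u ∈ M, φ u ∉ A} : ℚ) - #{φ : α ↪ V | ∀ u ∈ M, φ u ∉ B} := by
  have hcard : (#(B \ A) : ℚ) = #B - #A := cast_card_sdiff hAB
  rw [card_filter_forall_notMem_eq_sum, card_filter_forall_notMem_eq_sum, ← hcard,
    ← sum_card_filter_mem hV, ← sum_card_filter_mem_mul hV M (sdiff_subset : B \ A ⊆ B),
    ← sum_sub_distrib, ← sum_sub_distrib]
  refine sum_le_sum fun φ _ => ?_
  have h : #{u ∈ M | φ u ∈ B} = #{u ∈ M | φ u ∈ B \ A} + #{u ∈ M | φ u ∈ A} := by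
    rw [← card_union_of_disjoint]
    · congr 1
      ext u
      simp only [mem_filter, mem_union, mem_sdiff]
      have := @hAB (φ u)
      tauto
    · rw [disjoint_left]
      intro u hu hu'
      simp only [mem_filter, mem_sdiff] at hu hu'
      tauto
  rw [h]
  generalize #{u ∈ M | φ u ∈ B \ A} = a
  generalize #{u ∈ M | φ u ∈ A} = b
  push_cast
  have hb : (0 : ℚ) ≤ b := by positivity
  rcases a with _ | _ | a
  · simp
  · rcases b with _ | b
    · simp
    · simp only [zero_add, Nat.add_eq_zero_iff, one_ne_zero, and_false, if_false]
      push_cast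
      have hb : (0 : ℚ) ≤ b := by positivity
      linarith
  · have ha : (0 : ℚ) ≤ a := by positivity
    rcases b with _ | b
    · simp only [Nat.add_eq_zero_iff, one_ne_zero, and_false, false_and, if_false, if_true]
      push_cast
      nlinarith
    · simp only [Nat.add_eq_zero_iff, one_ne_zero, and_false, if_false]
      push_cast
      have hb : (0 : ℚ) ≤ b := by positivity
      nlinarith [mul_nonneg ha hb]

/-- Copies of `F` either map no element of `M` into `D`, or map some edge at an element of `M` to
an edge at a vertex of `D`. -/
lemma labeledCopies_le_add (hV : 2 ≤ Fintype.card V) (F : SimpleGraph α) (G : SimpleGraph V)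
    [DecidableRel G.Adj] {M : Finset α} (hM : ∀ u ∈ M, ∃ w, F.Adj u w) {D : Finset V} {r : ℕ}
    (hD : ∀ v ∈ D, G.degree v ≤ r) :
    (labeledCopies G F : ℚ) ≤
      #{φ : α ↪ V | ∀ u ∈ M, φ u ∉ D} + #M * #D * r * pairCount α V := by
  classical
  choose! w hw using hM
  have hsub : univ.filter (fun φ : α ↪ V => ∀ x y, F.Adj x y → G.Adj (φ x) (φ y)) ⊆
      univ.filter (fun φ : α ↪ V => ∀ u ∈ M, φ u ∉ D) ∪
        M.biUnion fun u => D.biUnion fun v => (G.neighborFinset v).biUnion fun y =>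
          univ.filter fun φ : α ↪ V => φ u = v ∧ φ (w u) = y := by
    intro φ hφ
    simp only [mem_filter, mem_univ, true_and] at hφ
    simp only [mem_union, mem_filter, mem_univ, true_and, mem_biUnion,
      SimpleGraph.mem_neighborFinset]
    by_cases h : ∀ u ∈ M, φ u ∉ D
    · exact Or.inl h
    · push Not at h
      obtain ⟨u, hu, hud⟩ := h
      exact Or.inr ⟨u, hu, φ u, hud, φ (w u), hφ _ _ (hw u hu), rfl, rfl⟩
  have h1 : labeledCopies G F ≤ #{φ : α ↪ V | ∀ u ∈ M, φ u ∉ D} +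
      ∑ u ∈ M, ∑ v ∈ D, ∑ y ∈ G.neighborFinset v, #{φ : α ↪ V | φ u = v ∧ φ (w u) = y} := by
    rw [labeledCopies_eq_card_filter]
    refine (card_le_card hsub).trans ((card_union_le _ _).trans ?_)
    refine Nat.add_le_add_left ?_ _
    refine card_biUnion_le.trans (sum_le_sum fun u _ => ?_)
    refine card_biUnion_le.trans (sum_le_sum fun v _ => ?_)
    exact card_biUnion_le
  have h2 : (labeledCopies G F : ℚ) ≤ #{φ : α ↪ V | ∀ u ∈ M, φ u ∉ D} +
      ∑ u ∈ M, ∑ v ∈ D, ∑ y ∈ G.neighborFinset v,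
        (#{φ : α ↪ V | φ u = v ∧ φ (w u) = y} : ℚ) := by
    exact_mod_cast h1
  refine h2.trans (add_le_add_right ?_ _)
  have h3 : ∀ u ∈ M, ∑ v ∈ D, ∑ y ∈ G.neighborFinset v,
      (#{φ : α ↪ V | φ u = v ∧ φ (w u) = y} : ℚ) ≤ #D * (r * pairCount α V) := by
    intro u hu
    have h4 : ∀ v ∈ D, ∑ y ∈ G.neighborFinset v,
        (#{φ : α ↪ V | φ u = v ∧ φ (w u) = y} : ℚ) ≤ r * pairCount α V := by
      intro v hv
      rw [sum_congr rfl fun y hy => card_filter_apply_eq_and hV (hw u hu).ne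
        ((G.mem_neighborFinset _ _).1 hy).ne, sum_const, nsmul_eq_mul,
        G.card_neighborFinset_eq_degree]
      exact mul_le_mul_of_nonneg_right (by exact_mod_cast hD v hv) (pairCount_nonneg α V hV)
    refine (sum_le_sum h4).trans ?_
    rw [sum_const, nsmul_eq_mul]
  refine (sum_le_sum h3).trans ?_
  rw [sum_const, nsmul_eq_mul]
  exact le_of_eq (by ring)

end Avoidance

section LowDegree

variable {α V : Type*} [Fintype α] [Fintype V] [DecidableEq α] [DecidableEq V]

lemma sq_le_mul_of_lt_two_mul {d r k t N : ℚ} (hd : 1 ≤ d) (hdr : d + 1 ≤ r) (hr : r ≤ 2 * d)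
    (hk : 1 ≤ k) (hkt : k ≤ t) (hN : 4 * d * t + 3 * d ^ 2 + 5 * t ≤ N + 1) :
    r * r ≤ (r - d) * N - (k - 1) * (r - d) * (r - 1) := by
  have h1 : r * r ≤ (d + 1) ^ 2 * (r - d) := by
    nlinarith [mul_nonneg (sub_nonneg.2 hdr) (by nlinarith : 0 ≤ d ^ 2 - (r - d))]
  have h2 : (k - 1) * (r - 1) ≤ (t - 1) * (2 * d - 1) :=
    mul_le_mul (by linarith) (by linarith) (by linarith) (by linarith)
  have h3 : (d + 1) ^ 2 ≤ N - (k - 1) * (r - 1) := by nlinarith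
  nlinarith [mul_le_mul_of_nonneg_right h3 (by linarith : 0 ≤ r - d)]

lemma bonferroni_le_of_add_one_mul_le {d r k N : ℚ} (hr : 2 * d ≤ r) (hr1 : 1 ≤ r)
    (hk : 1 ≤ k) (hN : (k + 1) * r ≤ N) :
    k * (k - 1) * r * (r - 1) / 2 + k * r * r ≤ N * (k * r - k * d) := by
  have h1 : 0 ≤ k * r := mul_nonneg (by linarith) (by linarith)
  have h0 : 0 ≤ k * (k - 1) * r :=
    mul_nonneg (mul_nonneg (by linarith) (by linarith)) (by linarith)
  have h2 : N * (k * r) ≤ 2 * (N * (k * r - k * d)) := by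
    nlinarith [mul_nonneg (mul_nonneg (by nlinarith : 0 ≤ N) (by linarith : 0 ≤ k))
      (sub_nonneg.2 hr)]
  nlinarith [mul_le_mul_of_nonneg_right hN h1]

lemma bonferroni_le_of_mul_le {d r k m N : ℚ} (hr1 : 1 ≤ r) (hm : 2 ≤ m) (hN : m * r ≤ N)
    (hN' : N ≤ (m + 1) * r) (hk : 4 * d * k ≤ N) :
    m * (m - 1) * r * (r - 1) / 2 + m * r * r ≤ N * (m * r - k * d) := by
  have h1 : 2 * r ≤ m * r := mul_le_mul_of_nonneg_right hm (by linarith)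
  have h2 : N * (4 * d * k) ≤ N * N := mul_le_mul_of_nonneg_left hk (by linarith)
  have h3 : 0 ≤ m * (m - 1) * r := mul_nonneg (mul_nonneg (by linarith) (by linarith)) (by linarith)
  have h4 : 0 ≤ (N - m * r) * (3 * (m * r) - N) := mul_nonneg (by linarith) (by linarith)
  nlinarith [mul_nonneg (by linarith : 0 ≤ m * r) (sub_nonneg.2 h1)]

/-- If more than `d` vertices have small degree, then `G` has at most as many copies of `F` as
there are injections mapping no nonisolated vertex of `F` into a fixed set of size `d`. -/
lemma labeledCopies_le_card_filter_forall_notMem {d r : ℕ} (F : SimpleGraph α)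
    [DecidableRel F.Adj] (G : SimpleGraph V) [DecidableRel G.Adj] (hd : 1 ≤ d)
    (hV : 4 * d * Fintype.card α + 3 * d ^ 2 + 5 * Fintype.card α ≤ Fintype.card V)
    (hdr : d < r) (hr : 2 * r < Fintype.card V) {D₀ D : Finset V} (hDD : D₀ ⊆ D)
    (hD₀ : #D₀ = d) (hD : #D = r) (hdeg : ∀ v ∈ D, G.degree v ≤ r) :
    labeledCopies G F ≤ #{φ : α ↪ V | ∀ u ∈ ({u | ∃ w, F.Adj u w} : Finset α), φ u ∉ D₀} := by
  set s : Finset α := {u | ∃ w, F.Adj u w}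
  have hV2 : 2 ≤ Fintype.card V := by omega
  have hs : ∀ M ⊆ s, ∀ u ∈ M, ∃ w, F.Adj u w := fun M hM u hu => by
    simpa [s] using hM hu
  have hst : #s ≤ Fintype.card α := card_le_univ s
  have hK := pairCount_nonneg α V hV2
  have hcop : ∀ M ⊆ s, (labeledCopies G F : ℚ) ≤
      #{φ : α ↪ V | ∀ u ∈ M, φ u ∉ D} + #M * r * r * pairCount α V := fun M hM => by
    have := labeledCopies_le_add hV2 F G (hs M hM) hdeg
    rwa [hD] at this
  have hVQ : 4 * (d : ℚ) * Fintype.card α + 3 * d ^ 2 + 5 * Fintype.card α ≤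
      (Fintype.card V - 1 : ℚ) + 1 := by
    rw [sub_add_cancel]
    exact_mod_cast hV
  have hstQ : (#s : ℚ) ≤ Fintype.card α := by exact_mod_cast hst
  have hdQ : (1 : ℚ) ≤ d := by exact_mod_cast hd
  have hdrQ : (d : ℚ) + 1 ≤ r := by exact_mod_cast hdr
  rcases Nat.eq_zero_or_pos #s with hs0 | hs0
  · have := hcop s (Subset.refl s)
    rw [card_eq_zero] at hs0
    rw [hs0] at this ⊢
    simpa using this
  have hs1 : (1 : ℚ) ≤ #s := by exact_mod_cast hs0
  suffices h : (labeledCopies G F : ℚ) ≤ #{φ : α ↪ V | ∀ u ∈ s, φ u ∉ D₀} by exact_mod_cast h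
  have hN : (Fintype.card V : ℚ) - 1 = (Fintype.card V - 1 : ℕ) := by
    rw [Nat.cast_sub (by omega)]
    simp
  rcases lt_or_ge r (2 * d) with hlt | hge
  · have h1 := hcop s (Subset.refl s)
    have h2 := le_card_filter_forall_notMem_sub hV2 s hDD
    rw [hD, hD₀] at h2
    have h3 := sq_le_mul_of_lt_two_mul hdQ hdrQ (by exact_mod_cast hlt.le) hs1 hstQ hVQ
    have h4 := mul_le_mul_of_nonneg_right (mul_le_mul_of_nonneg_left h3
      (by positivity : (0 : ℚ) ≤ #s)) hK
    linarith
  · have key : ∀ m ≤ #s, (m * (m - 1) * r * (r - 1) / 2 + m * r * r : ℚ) ≤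
        (Fintype.card V - 1) * (m * r - #s * d) →
        (labeledCopies G F : ℚ) ≤ #{φ : α ↪ V | ∀ u ∈ s, φ u ∉ D₀} := by
      intro m hm hineq
      obtain ⟨M, hM, rfl⟩ := exists_subset_card_eq hm
      have h1 := hcop M hM
      have h2 := card_filter_forall_notMem_le hV2 M D
      have h3 := le_card_filter_forall_notMem hV2 s D₀
      rw [hD] at h2
      rw [hD₀] at h3
      have h4 := mul_le_mul_of_nonneg_right hineq hK
      linarith
    have hr1 : (1 : ℚ) ≤ r := by linarith
    rcases le_or_gt ((#s + 1) * r) (Fintype.card V - 1) with hle | hgt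
    · refine key _ le_rfl (bonferroni_le_of_add_one_mul_le (by exact_mod_cast hge) hr1 hs1 ?_)
      rw [hN]
      exact_mod_cast hle
    · have hr0 : 0 < r := by omega
      have hm : (Fintype.card V - 1) / r < #s + 1 := (Nat.div_lt_iff_lt_mul hr0).2 hgt
      have hm2 : 2 ≤ (Fintype.card V - 1) / r := (Nat.le_div_iff_mul_le hr0).2 (by omega)
      have hlow := Nat.div_mul_le_self (Fintype.card V - 1) r
      have hupp := (Nat.lt_mul_of_div_lt (Nat.lt_succ_self ((Fintype.card V - 1) / r)) hr0).le
      refine key ((Fintype.card V - 1) / r) (by omega)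
        (bonferroni_le_of_mul_le hr1 (by exact_mod_cast hm2) ?_ ?_ ?_)
      · rw [hN]
        exact_mod_cast hlow
      · rw [hN]
        exact_mod_cast hupp
      · nlinarith

end LowDegree

section Stars

variable {α V : Type*} [Fintype α] [Fintype V]

open Classical in
/-- Injections mapping the star of `F` at `u` to a star of `G` at `v` with a leaf in `D`. -/
noncomputable def starEmbeddings (F : SimpleGraph α) (G : SimpleGraph V) (D : Finset V) (u : α)
    (v : V) : Finset (α ↪ V) :=
  {φ | φ u = v ∧ (∀ w, F.Adj u w → G.Adj v (φ w)) ∧ ∃ w, F.Adj u w ∧ φ w ∈ D}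

open Classical in
/-- Injections mapping `u` to `v` and the neighbours of `u` into `C'`, not all of them into `C`. -/
noncomputable def shiftedStarEmbeddings (F : SimpleGraph α) (C C' : Finset V) (u : α) (v : V) :
    Finset (α ↪ V) :=
  {φ | φ u = v ∧ (∀ w, F.Adj u w → φ w ∈ C') ∧ ∃ w, F.Adj u w ∧ φ w ∉ C}

open Classical in
/-- The members of `shiftedStarEmbeddings` for which `u` is the only vertex mapped into `D`. -/
noncomputable def isolatedStarEmbeddings (F : SimpleGraph α) (C C' D : Finset V) (u : α) (v : V) :
    Finset (α ↪ V) :=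
  {φ ∈ shiftedStarEmbeddings F C C' u v | ∀ w, w ≠ u → φ w ∉ D}

variable {F : SimpleGraph α} {G : SimpleGraph V} {C C' D : Finset V} {d : ℕ}

lemma mem_starEmbeddings {u : α} {v : V} {φ : α ↪ V} : φ ∈ starEmbeddings F G D u v ↔
    φ u = v ∧ (∀ w, F.Adj u w → G.Adj v (φ w)) ∧ ∃ w, F.Adj u w ∧ φ w ∈ D := by
  simp [starEmbeddings]

lemma mem_shiftedStarEmbeddings {u : α} {v : V} {φ : α ↪ V} :
    φ ∈ shiftedStarEmbeddings F C C' u v ↔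
      φ u = v ∧ (∀ w, F.Adj u w → φ w ∈ C') ∧ ∃ w, F.Adj u w ∧ φ w ∉ C := by
  simp [shiftedStarEmbeddings]

lemma mem_isolatedStarEmbeddings {u : α} {v : V} {φ : α ↪ V} :
    φ ∈ isolatedStarEmbeddings F C C' D u v ↔
      φ ∈ shiftedStarEmbeddings F C C' u v ∧ ∀ w, w ≠ u → φ w ∉ D := by
  simp [isolatedStarEmbeddings]

lemma card_starEmbeddings_le [DecidableRel G.Adj] (hC'D : Disjoint C' D) (hCC' : C ⊆ C')
    (hC' : #C' = d) {v : V} (hv : v ∈ D) (hdeg : G.degree v ≤ d)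
    (hadj : ∀ y, y ∉ D → (G.Adj v y ↔ y ∈ C)) (u : α) :
    #(starEmbeddings F G D u v) ≤ #(shiftedStarEmbeddings F C C' u v) := by
  classical
  let S := {y ∈ D | G.Adj v y}
  have hSC : Disjoint S C := by
    rw [disjoint_left]
    intro x hx hxC
    exact disjoint_left.1 hC'D (hCC' hxC) (mem_filter.1 hx).1
  have hS : #S ≤ #(C' \ C) := by
    have h1 : S ∪ C ⊆ G.neighborFinset v := by
      intro x hx
      rw [SimpleGraph.mem_neighborFinset]
      rcases mem_union.1 hx with h | h
      · exact (mem_filter.1 h).2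
      · exact (hadj x (disjoint_left.1 hC'D (hCC' h))).2 h
    have h2 := card_le_card h1
    rw [card_union_of_disjoint hSC, SimpleGraph.card_neighborFinset_eq_degree] at h2
    rw [card_sdiff_of_subset hCC']
    omega
  obtain ⟨E, hE, hES⟩ := exists_subset_card_eq hS
  let e := Finset.equivOfCardEq hES.symm
  let f : V → V := fun x => if h : x ∈ S then e ⟨x, h⟩ else x
  have hfS : ∀ x (h : x ∈ S), f x = e ⟨x, h⟩ := fun x h => by simp [f, h]
  have hfN : ∀ x, x ∉ S → f x = x := fun x h => by simp [f, h]
  have hfE : ∀ x ∈ S, f x ∈ C' ∧ f x ∉ C := fun x h => by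
    rw [hfS x h]
    exact mem_sdiff.1 (hE (e _).2)
  have hvS : v ∉ S := by simp [S]
  have hvC' : v ∉ C' := disjoint_right.1 hC'D hv
  have hinj : Set.InjOn f (S ∪ insert v C : Finset V) := by
    have hcross : ∀ x ∈ S, ∀ y ∈ insert v C, f x ≠ f y := by
      intro x hx y hy h
      have hyS : y ∉ S := by
        rcases mem_insert.1 hy with rfl | hy
        · exact hvS
        · exact disjoint_right.1 hSC hy
      rw [hfN y hyS] at h
      rcases mem_insert.1 hy with rfl | hy
      · exact hvC' (h ▸ (hfE x hx).1)
      · exact (hfE x hx).2 (h ▸ hy)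
    intro x hx y hy h
    rw [mem_coe, mem_union] at hx hy
    by_cases hxS : x ∈ S <;> by_cases hyS : y ∈ S
    · rw [hfS x hxS, hfS y hyS, Subtype.coe_inj] at h
      simpa using e.injective h
    · exact absurd h (hcross x hxS y (hy.resolve_left hyS))
    · exact absurd h.symm (hcross y hyS x (hx.resolve_left hxS))
    · rwa [hfN x hxS, hfN y hyS] at h
  obtain ⟨g, hg⟩ := Finset.exists_equiv_extend_of_card_eq (t := (univ : Finset V))
    (by simp) (subset_univ _) hinj
  let σ : Equiv.Perm V := g.trans (Equiv.subtypeUnivEquiv fun x => mem_univ x)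
  have hσ : ∀ x ∈ S ∪ insert v C, σ x = f x := hg
  have hσv : σ v = v := by rw [hσ v (by simp), hfN v hvS]
  have hσC : ∀ x ∈ C, σ x = x := fun x hx => by
    rw [hσ x (by simp [hx]), hfN x (disjoint_right.1 hSC hx)]
  have hσS : ∀ x ∈ S, σ x ∈ C' ∧ σ x ∉ C := fun x hx => by
    rw [hσ x (mem_union_left _ hx)]
    exact hfE x hx
  refine card_le_card_of_perm σ fun φ hφ => ?_
  obtain ⟨h1, h2, w, hw, hwD⟩ := mem_starEmbeddings.1 hφ
  simp only [mem_shiftedStarEmbeddings, Function.Embedding.trans_apply, Equiv.coe_toEmbedding]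
  refine ⟨by rw [h1, hσv], fun w hw => ?_, w, hw, ?_⟩
  · by_cases hwD : φ w ∈ D
    · exact (hσS _ (mem_filter.2 ⟨hwD, h2 w hw⟩)).1
    · have hwC := (hadj _ hwD).1 (h2 w hw)
      rw [hσC _ hwC]
      exact hCC' hwC
  · exact (hσS _ (mem_filter.2 ⟨hwD, h2 w hw⟩)).2

lemma card_shiftedStarEmbeddings_le (hC'D : Disjoint C' D) (hC' : #C' = d) (hD : #D = d)
    (hV : 2 * (Fintype.card α * d) + d + 1 ≤ Fintype.card V) {v : V} (hv : v ∈ D) (hd : 1 ≤ d)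
    (u : α) :
    #(shiftedStarEmbeddings F C C' u v) ≤ 2 * #(isolatedStarEmbeddings F C C' D u v) := by
  classical
  set X := shiftedStarEmbeddings F C C' u v
  have hvC' : v ∉ C' := disjoint_right.1 hC'D hv
  have hfiber : ∀ w, w ≠ u → ∀ y ∈ D, (Fintype.card V - d - 1) * #{φ ∈ X | φ w = y} ≤ #X := by
    intro w hwu y hy
    by_cases hyv : y = v
    · rw [filter_false_of_mem]
      · simp
      · rintro φ hφ h
        exact hwu (φ.injective (h.trans (hyv.trans (mem_shiftedStarEmbeddings.1 hφ).1.symm)))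
    have hyC' : y ∉ C' := disjoint_right.1 hC'D hy
    have h1 : ∀ z ∈ (insert v C')ᶜ, #{φ ∈ X | φ w = y} ≤ #{φ ∈ X | φ w = z} := by
      intro z hz
      simp only [mem_compl, mem_insert, not_or] at hz
      refine card_le_card_of_perm (Equiv.swap y z) fun φ hφ => ?_
      simp only [X, mem_filter, mem_shiftedStarEmbeddings, Function.Embedding.trans_apply,
        Equiv.coe_toEmbedding] at hφ ⊢
      obtain ⟨⟨h1, h2, w', hw', hwC⟩, h3⟩ := hφ
      have hfix : ∀ x ∈ C', Equiv.swap y z x = x := fun x hx =>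
        Equiv.swap_apply_of_ne_of_ne (fun h => hyC' (h ▸ hx)) (fun h => hz.2 (h ▸ hx))
      refine ⟨⟨?_, fun x hx => ?_, w', hw', ?_⟩, ?_⟩
      · rw [h1, Equiv.swap_apply_of_ne_of_ne (Ne.symm hyv) (Ne.symm hz.1)]
      · rw [hfix _ (h2 x hx)]
        exact h2 x hx
      · rwa [hfix _ (h2 w' hw')]
      · rw [h3, Equiv.swap_apply_left]
    have h2 := sum_le_sum h1
    rw [sum_const, card_compl, card_insert_of_notMem hvC', hC', smul_eq_mul, ← Nat.sub_sub] at h2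
    refine h2.trans ?_
    rw [← card_biUnion]
    · exact card_le_card (biUnion_subset.2 fun z _ => filter_subset _ _)
    · intro z _ z' _ hzz'
      rw [Function.onFun, disjoint_left]
      intro φ hφ hφ'
      exact hzz' ((mem_filter.1 hφ).2.symm.trans (mem_filter.1 hφ').2)
  have hcover : X ⊆ isolatedStarEmbeddings F C C' D u v ∪
      (univ.erase u).biUnion fun w => D.biUnion fun y => {φ ∈ X | φ w = y} := by
    intro φ hφ
    simp only [mem_union, mem_isolatedStarEmbeddings, mem_biUnion, mem_erase, mem_univ, and_true,
      mem_filter]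
    by_cases h : ∀ w, w ≠ u → φ w ∉ D
    · exact Or.inl ⟨hφ, h⟩
    · push Not at h
      obtain ⟨w, hw, hwD⟩ := h
      exact Or.inr ⟨w, hw, φ w, hwD, hφ, rfl⟩
  have h1 : #X ≤ #(isolatedStarEmbeddings F C C' D u v) +
      ∑ w ∈ univ.erase u, ∑ y ∈ D, #{φ ∈ X | φ w = y} := by
    refine (card_le_card hcover).trans ((card_union_le _ _).trans ?_)
    refine Nat.add_le_add_left ?_ _
    refine card_biUnion_le.trans (sum_le_sum fun w _ => ?_)
    exact card_biUnion_le
  have h2 : (Fintype.card V - d - 1) * ∑ w ∈ univ.erase u, ∑ y ∈ D, #{φ ∈ X | φ w = y} ≤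
      Fintype.card α * d * #X := by
    simp_rw [mul_sum]
    refine (sum_le_sum fun w hw => sum_le_sum fun y hy => hfiber w (mem_erase.1 hw).1 y hy).trans ?_
    simp only [sum_const, smul_eq_mul, hD]
    rw [← mul_assoc]
    exact Nat.mul_le_mul_right _ (Nat.mul_le_mul_right _ (card_le_univ _))
  set S := ∑ w ∈ univ.erase u, ∑ y ∈ D, #{φ ∈ X | φ w = y}
  obtain ⟨k, hk⟩ : ∃ k, Fintype.card V - d - 1 = k := ⟨_, rfl⟩
  have hk2 : 2 * (Fintype.card α * d) ≤ k := by omega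
  rw [hk] at h2
  have hα : 1 ≤ Fintype.card α := Fintype.card_pos_iff.2 ⟨u⟩
  have hαd : 1 ≤ Fintype.card α * d := Nat.mul_pos hα hd
  have h3 : 2 * S ≤ #X := by
    by_contra! h
    nlinarith
  omega

/-- If all edges from `D` to its complement end in `C`, then the edges inside `D` do not give more
copies of `F` than joining `D` to a larger set `C'` instead. -/
lemma labeledCopies_le_of_adj_iff [DecidableEq V] [DecidableRel F.Adj] [DecidableRel G.Adj]
    (hC'D : Disjoint C' D) (hCC' : C ⊆ C') (hC' : #C' = d) (hD : #D = d)
    (hV : 2 * (Fintype.card α * d) + d + 1 ≤ Fintype.card V) (hd : 1 ≤ d)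
    (hdeg : ∀ v ∈ D, G.degree v ≤ d) (hadj : ∀ v ∈ D, ∀ y, y ∉ D → (G.Adj v y ↔ y ∈ C)) :
    labeledCopies G F ≤ #{φ : α ↪ V | ∀ x y, F.Adj x y →
      (φ x ∉ D ∧ φ y ∉ D) ∨ (φ x ∈ D ∧ φ y ∈ C') ∨ (φ x ∈ C' ∧ φ y ∈ D)} := by
  classical
  let P : Finset (α ↪ V) := {φ | (∀ x y, F.Adj x y → G.Adj (φ x) (φ y)) ∧
    ∀ x y, F.Adj x y → φ x ∈ D → φ y ∉ D}
  let Q : Finset (α ↪ V) := {φ | (∀ x y, F.Adj x y → G.Adj (φ x) (φ y)) ∧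
    ¬ ∀ x y, F.Adj x y → φ x ∈ D → φ y ∉ D}
  let I : Finset (α × V) := univ ×ˢ D
  let Y : Finset (α ↪ V) := I.biUnion fun p => isolatedStarEmbeddings F C C' D p.1 p.2
  have hPQ : labeledCopies G F = #P + #Q := by
    rw [labeledCopies_eq_card_filter,
      ← card_filter_add_card_filter_not (fun φ : α ↪ V => ∀ x y, F.Adj x y → φ x ∈ D → φ y ∉ D),
      filter_filter, filter_filter]
  have hQ : 2 * #Q ≤ ∑ p ∈ I, #(starEmbeddings F G D p.1 p.2) := by
    have h1 : ∀ φ ∈ Q, 2 ≤ #{p ∈ I | φ ∈ starEmbeddings F G D p.1 p.2} := by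
      intro φ hφ
      simp only [Q, mem_filter, mem_univ, true_and] at hφ
      obtain ⟨hφ, hne⟩ := hφ
      push Not at hne
      obtain ⟨x, y, hxy, hx, hy⟩ := hne
      have h2 : ({(x, φ x), (y, φ y)} : Finset (α × V)) ⊆
          {p ∈ I | φ ∈ starEmbeddings F G D p.1 p.2} := by
        intro p hp
        simp only [mem_insert, mem_singleton] at hp
        simp only [I, mem_filter, mem_product, mem_univ, true_and, mem_starEmbeddings]
        rcases hp with rfl | rfl
        · exact ⟨hx, rfl, fun w hw => hφ _ _ hw, y, hxy, hy⟩
        · exact ⟨hy, rfl, fun w hw => hφ _ _ hw, x, hxy.symm, hx⟩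
      refine le_trans ?_ (card_le_card h2)
      rw [card_pair]
      simp [hxy.ne]
    calc 2 * #Q = ∑ φ ∈ Q, 2 := by simp [mul_comm]
      _ ≤ ∑ φ ∈ Q, #{p ∈ I | φ ∈ starEmbeddings F G D p.1 p.2} := sum_le_sum h1
      _ ≤ ∑ φ, #{p ∈ I | φ ∈ starEmbeddings F G D p.1 p.2} :=
          sum_le_sum_of_subset (subset_univ _)
      _ = ∑ p ∈ I, #{φ | φ ∈ starEmbeddings F G D p.1 p.2} := by
          simp_rw [card_filter]
          exact sum_comm
      _ = ∑ p ∈ I, #(starEmbeddings F G D p.1 p.2) := by simp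
  have hY : #Y = ∑ p ∈ I, #(isolatedStarEmbeddings F C C' D p.1 p.2) := by
    refine card_biUnion fun p hp q hq hpq => ?_
    rw [Function.onFun, disjoint_left]
    intro φ hφ hφ'
    rw [mem_isolatedStarEmbeddings, mem_shiftedStarEmbeddings] at hφ hφ'
    have hpD : φ p.1 ∈ D := hφ.1.1 ▸ (mem_product.1 hp).2
    have h1 : p.1 = q.1 := by
      by_contra h
      exact hφ'.2 _ h hpD
    exact hpq (Prod.ext h1 (by rw [← hφ.1.1, ← hφ'.1.1, h1]))
  have hle : ∀ p ∈ I, #(starEmbeddings F G D p.1 p.2) ≤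
      2 * #(isolatedStarEmbeddings F C C' D p.1 p.2) := by
    intro p hp
    have hv := (mem_product.1 hp).2
    exact (card_starEmbeddings_le hC'D hCC' hC' hv (hdeg _ hv) (hadj _ hv) _).trans
      (card_shiftedStarEmbeddings_le hC'D hC' hD hV hv hd _)
  have hQY : #Q ≤ #Y := by
    have h1 := hQ.trans (sum_le_sum hle)
    rw [← mul_sum, ← hY] at h1
    omega
  have hmemY : ∀ φ ∈ Y, ∃ u, φ u ∈ D ∧ (∀ w, F.Adj u w → φ w ∈ C') ∧
      (∃ w, F.Adj u w ∧ φ w ∉ C) ∧ ∀ w, w ≠ u → φ w ∉ D := by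
    intro φ hφ
    obtain ⟨p, hp, hφ⟩ := mem_biUnion.1 hφ
    rw [mem_isolatedStarEmbeddings, mem_shiftedStarEmbeddings] at hφ
    exact ⟨p.1, hφ.1.1 ▸ (mem_product.1 hp).2, hφ.1.2.1, hφ.1.2.2, hφ.2⟩
  have hPY : Disjoint P Y := by
    rw [disjoint_left]
    intro φ hP hφ
    obtain ⟨u, hu, hC', ⟨w, hw, hwC⟩, -⟩ := hmemY φ hφ
    exact hwC ((hadj _ hu _ (disjoint_left.1 hC'D (hC' w hw))).1 ((mem_filter.1 hP).2.1 _ _ hw))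
  rw [hPQ]
  refine (Nat.add_le_add_left hQY _).trans ?_
  rw [← card_union_of_disjoint hPY]
  refine card_le_card fun φ hφ => ?_
  simp only [mem_filter, mem_univ, true_and]
  intro x y hxy
  rcases mem_union.1 hφ with hP | hφ
  · obtain ⟨h1, h2⟩ := (mem_filter.1 hP).2
    by_cases hx : φ x ∈ D
    · exact Or.inr (Or.inl ⟨hx, hCC' ((hadj _ hx _ (h2 x y hxy hx)).1 (h1 x y hxy))⟩)
    · by_cases hy : φ y ∈ D
      · exact Or.inr (Or.inr ⟨hCC' ((hadj _ hy _ hx).1 (h1 x y hxy).symm), hy⟩)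
      · exact Or.inl ⟨hx, hy⟩
  · obtain ⟨u, hu, hC', -, hD⟩ := hmemY φ hφ
    by_cases hx : x = u
    · subst hx
      exact Or.inr (Or.inl ⟨hu, hC' _ hxy⟩)
    · by_cases hy : y = u
      · subst hy
        exact Or.inr (Or.inr ⟨hC' _ hxy.symm, hu⟩)
      · exact Or.inl ⟨hD _ hx, hD _ hy⟩

end Stars

lemma labeledCopies_mono {α V : Type*} [Fintype α] [Fintype V] {G H : SimpleGraph V} (h : G ≤ H)
    (F : SimpleGraph α) : labeledCopies G F ≤ labeledCopies H F :=
  Nat.card_le_card_of_injective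
    (Subtype.map id fun _ hφ x y hxy => h (hφ x y hxy))
    (Subtype.map_injective _ Function.injective_id)

/-- If only `d` vertices have degree `d` and the others form a clique, then the neighbours of the
`d` low vertices outside their own set are the same for each of them. -/
lemma exists_forall_adj_iff {V : Type*} [Fintype V] [DecidableEq V] {G : SimpleGraph V}
    [DecidableRel G.Adj] {d : ℕ} {D : Finset V} (hd : 1 ≤ d) (hD : #D = d)
    (hdeg : ∀ v ∈ D, G.degree v = d) (hclique : ∀ x y, x ≠ y → x ∉ D → y ∉ D → G.Adj x y)
    (hore : ∀ u v, u ≠ v → ¬ G.Adj u v → G.degree u + G.degree v < Fintype.card V) :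
    ∃ C : Finset V, Disjoint C D ∧ #C ≤ d ∧ ∀ v ∈ D, ∀ y, y ∉ D → (G.Adj v y ↔ y ∈ C) := by
  refine ⟨({y | y ∉ D ∧ ∀ v ∈ D, G.Adj v y} : Finset V), ?_, ?_,
    fun v hv y hy => ⟨fun h => ?_, fun h => ?_⟩⟩
  · rw [disjoint_left]
    exact fun x hx => (mem_filter.1 hx).2.1
  · obtain ⟨v, hv⟩ := card_pos.1 (show 0 < #D by omega)
    rw [← hdeg v hv, ← G.card_neighborFinset_eq_degree]
    refine card_le_card fun x hx => ?_
    rw [G.mem_neighborFinset]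
    exact (mem_filter.1 hx).2.2 v hv
  · refine mem_filter.2 ⟨mem_univ _, hy, fun v' hv' => ?_⟩
    by_contra hadj
    have h1 := hore v' y (fun h => hy (h ▸ hv')) hadj
    rw [hdeg v' hv'] at h1
    have h2 : insert v (Dᶜ.erase y) ⊆ G.neighborFinset y := by
      intro x hx
      rw [G.mem_neighborFinset]
      rcases mem_insert.1 hx with rfl | hx
      · exact h.symm
      · obtain ⟨hxy, hx⟩ := mem_erase.1 hx
        exact hclique _ _ hxy.symm hy (mem_compl.1 hx)
    have h3 := card_le_card h2
    rw [card_insert_of_notMem (by simp [hv]), card_erase_of_mem (by simpa using hy), card_compl,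
      G.card_neighborFinset_eq_degree, hD] at h3
    have h4 := card_le_univ (insert y D)
    rw [card_insert_of_notMem hy, hD] at h4
    omega
  · exact (mem_filter.1 h).2.2 v hv

theorem Hnd_maximizes_labeled_copies (n d t : ℕ) (ht : 3 ≤ t) (hd : 1 ≤ d)
    (hn : 4 * d * t + 3 * d ^ 2 + 5 * t ≤ n) (F : SimpleGraph (Fin t))
    (G : SimpleGraph (Fin n)) [DecidableRel G.Adj]
    (hδ : ∀ v, d ≤ G.degree v) (hG : ¬ G.IsHamiltonian) :
    labeledCopies G F ≤ labeledCopies (Hnd n d) F := by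
  classical
  have hdt : 3 * d ≤ d * t := by nlinarith
  have hn' : 4 * (d * t) + 3 * d ^ 2 + 5 * t ≤ n := by rwa [← mul_assoc]
  have hV : 3 ≤ Fintype.card (Fin n) := by
    rw [Fintype.card_fin]
    omega
  have : Nonempty (Fin n) := Fintype.card_pos_iff.1 (by omega)
  obtain ⟨H, hGH, hH⟩ := Finite.exists_le_maximal (p := fun H => ¬ HasSpanningCycle H)
    (a := G) (fun h => hG (h.isHamiltonian hV))
  refine (labeledCopies_mono hGH F).trans ?_
  have hδ' : ∀ v, d ≤ H.degree v := fun v => (hδ v).trans (SimpleGraph.degree_le_of_le hGH)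
  have hore : ∀ u v, u ≠ v → ¬ H.Adj u v → H.degree u + H.degree v < Fintype.card (Fin n) :=
    fun u v => degree_add_degree_lt_of_maximal hV hH
  obtain ⟨r, hr, hrD, hmax, hclique⟩ := exists_degree_threshold hore
  rw [Fintype.card_fin] at hr hmax
  rcases lt_trichotomy r d with hrd | rfl | hrd
  · refine absurd ?_ hH.prop
    have htop : H = ⊤ := by
      ext x y
      rw [SimpleGraph.top_adj]
      exact ⟨fun h => h.ne, fun h => hclique x y h (hrd.trans_le (hδ' x)) (hrd.trans_le (hδ' y))⟩
    rw [htop]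
    exact hasSpanningCycle_top (by omega)
  · set D : Finset (Fin n) := {v | H.degree v ≤ r}
    have hmemD : ∀ v, v ∈ D ↔ H.degree v ≤ r := by simp [D]
    have hD : #D = r := by
      have h1 := hmax (r + 1) (by omega) (by omega)
      have h2 : #D ≤ #{v | H.degree v ≤ r + 1} :=
        card_le_card fun v hv => mem_filter.2 ⟨mem_univ _, ((hmemD v).1 hv).trans (by omega)⟩
      omega
    obtain ⟨C, hCD, hC, hadj⟩ := exists_forall_adj_iff hd hD
      (fun v hv => le_antisymm ((hmemD v).1 hv) (hδ' v))
      (fun x y hxy hx hy => hclique x y hxy (by simpa [hmemD] using hx) (by simpa [hmemD] using hy))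
      hore
    obtain ⟨C', hCC', hC'D, hC'⟩ := exists_subsuperset_card_eq
      (subset_compl_iff_disjoint_right.2 hCD) hC
      (by rw [card_compl, hD, Fintype.card_fin]; omega)
    have hC'D := subset_compl_iff_disjoint_right.1 hC'D
    refine (labeledCopies_le_of_adj_iff (F := F) hC'D hCC' hC' hD ?_ hd
      (fun v hv => (hmemD v).1 hv) hadj).trans ?_
    · rw [Fintype.card_fin, Fintype.card_fin, mul_comm t]
      omega
    · exact card_le_labeledCopies_Hnd (by omega) F hC'D hC' hD _ fun φ hφ => by
        simpa using hφ
  · obtain ⟨D, hDsub, hD⟩ := exists_subset_card_eq hrD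
    obtain ⟨D₀, hDD, hD₀⟩ := exists_subset_card_eq (show d ≤ #D by omega)
    obtain ⟨C, hCD, hC⟩ := exists_subset_card_eq (s := D₀ᶜ) (n := d)
      (by rw [card_compl, hD₀, Fintype.card_fin]; omega)
    refine (labeledCopies_le_card_filter_forall_notMem F H hd (by simpa using hn) hrd
      (by simpa using hr) hDD hD₀ hD fun v hv => (mem_filter.1 (hDsub hv)).2).trans ?_
    refine card_le_labeledCopies_Hnd (by omega) F (subset_compl_iff_disjoint_right.1 hCD) hC hD₀ _
      fun φ hφ x y hxy => ?_
    simp only [mem_filter, mem_univ, true_and] at hφ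
    exact Or.inl ⟨hφ x ⟨y, hxy⟩, hφ y ⟨x, hxy.symm⟩⟩
end

section
/- Let n ≥ 3 and 1 ≤ d ≤ ⌊(n-1)/2⌋, and suppose G is an n-vertex nonhamiltonian graph with minimum degree δ(G) ≥ d such that for some k ≥ 2, the number of k-cliques of G exceeds max{h_k(n,d+1), h_k(n,⌊(n-1)/2⌋)}, where h_k(n,x) = binomial(n-x,k) + x·binomial(x,k-1). Then G is a subgraph of either H_{n,d} or K'_{n,d}. -/
/-- `h_k(n,x) = C(n-x,k) + x·C(x,k-1)`. -/
def hClique (n x k : ℕ) : ℕ := (n - x).choose k + x * x.choose (k - 1)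

theorem Nat.le_max_of_two_mul_le_add {g : ℕ → ℕ}
    (hg : ∀ x, 2 * g (x + 1) ≤ g x + g (x + 2)) {a r b : ℕ} (har : a ≤ r) (hrb : r ≤ b) :
    g r ≤ max (g a) (g b) := by
  have up : ∀ x, g x ≤ g (x + 1) → g (x + 1) ≤ g (x + 1 + 1) := fun x h => by
    have : 2 * g (x + 1) ≤ g x + g (x + 1 + 1) := hg x
    omega
  have key : g r ≤ g a ∨ g r ≤ g (r + 1) := by
    induction r, har using Nat.le_induction with
    | base => exact Or.inl le_rfl
    | succ r _ ih =>
      have := up r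
      rcases ih (by omega) with h | h <;> omega
  rcases key with h | h
  · exact le_max_of_le_left h
  · refine le_max_of_le_right ?_
    have : g r ≤ g b ∧ g b ≤ g (b + 1) := by
      induction b, hrb using Nat.le_induction with
      | base => exact ⟨le_rfl, h⟩
      | succ b _ ih => exact ⟨ih.1.trans ih.2, up b ih.2⟩
    exact this.1

theorem Nat.two_mul_choose_succ_le (x j : ℕ) :
    2 * (x + 1).choose j ≤ x.choose j + (x + 2).choose j := by
  cases j with
  | zero => simp
  | succ j =>
    have h1 := Nat.choose_succ_succ x j
    have h2 : (x + 2).choose (j + 1) = (x + 1).choose j + (x + 1).choose (j + 1) :=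
      Nat.choose_succ_succ (x + 1) j
    have h3 : x.choose j ≤ (x + 1).choose j := Nat.choose_mono j (by omega)
    simp only [Nat.succ_eq_add_one] at h1
    omega

theorem two_mul_hClique_succ_le (n k x : ℕ) :
    2 * hClique n (x + 1) k ≤ hClique n x k + hClique n (x + 2) k := by
  have h1 : 2 * (n - (x + 1)).choose k ≤ (n - x).choose k + (n - (x + 2)).choose k := by
    rcases le_or_gt (x + 2) n with h | h
    · obtain ⟨y, rfl⟩ := Nat.exists_eq_add_of_le h
      have := Nat.two_mul_choose_succ_le y k
      rw [show x + 2 + y - (x + 1) = y + 1 by omega, show x + 2 + y - x = y + 2 by omega,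
        show x + 2 + y - (x + 2) = y by omega]
      omega
    · have : (n - (x + 1)).choose k ≤ (n - x).choose k := Nat.choose_mono k (by omega)
      rw [show n - (x + 2) = n - (x + 1) by omega]
      omega
  have h2 := Nat.two_mul_choose_succ_le x (k - 1)
  have h3 : (x + 1).choose (k - 1) ≤ (x + 2).choose (k - 1) := Nat.choose_mono _ (by omega)
  have h4 : x.choose (k - 1) ≤ (x + 1).choose (k - 1) := Nat.choose_mono _ (by omega)
  unfold hClique
  nlinarith

theorem hClique_le_max (n k : ℕ) {a r b : ℕ} (har : a ≤ r) (hrb : r ≤ b) :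
    hClique n r k ≤ max (hClique n a k) (hClique n b k) :=
  Nat.le_max_of_two_mul_le_add (g := fun x => hClique n x k) (two_mul_hClique_succ_le n k) har hrb

namespace SimpleGraph

theorem card_cliqueFinset_le_hClique {V : Type*} [Fintype V] [DecidableEq V]
    (G : SimpleGraph V) [DecidableRel G.Adj] {k r : ℕ} (S : Finset V)
    (hS : r ≤ S.card) (hdeg : ∀ v ∈ S, G.degree v ≤ r) :
    (G.cliqueFinset k).card ≤ hClique (Fintype.card V) r k := by
  obtain ⟨T, hTS, hT⟩ := Finset.exists_subset_card_eq hS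
  have hsub : G.cliqueFinset k ⊆ Tᶜ.powersetCard k ∪
      T.biUnion (fun v => ((G.neighborFinset v).powersetCard (k - 1)).image (insert v)) := by
    intro s hs
    rw [mem_cliqueFinset_iff] at hs
    by_cases h : ∃ v ∈ T, v ∈ s
    · obtain ⟨v, hvT, hvs⟩ := h
      refine Finset.mem_union_right _ (Finset.mem_biUnion.2 ⟨v, hvT, Finset.mem_image.2
        ⟨s.erase v, Finset.mem_powersetCard.2 ⟨?_, ?_⟩, Finset.insert_erase hvs⟩⟩)
      · intro w hw
        rw [Finset.mem_erase] at hw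
        rw [mem_neighborFinset]
        exact hs.isClique hvs hw.2 hw.1.symm
      · rw [Finset.card_erase_of_mem hvs, hs.card_eq]
    · push Not at h
      refine Finset.mem_union_left _ (Finset.mem_powersetCard.2 ⟨?_, hs.card_eq⟩)
      intro w hw
      exact Finset.mem_compl.2 fun hwT => h w hwT hw
  refine (Finset.card_le_card hsub).trans ((Finset.card_union_le _ _).trans ?_)
  refine Nat.add_le_add ?_ ?_
  · rw [Finset.card_powersetCard, Finset.card_compl, hT]
  · rw [← hT]
    refine Finset.card_biUnion_le_card_mul _ _ _ fun v hv => Finset.card_image_le.trans ?_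
    rw [Finset.card_powersetCard, card_neighborFinset_eq_degree]
    exact Nat.choose_mono _ ((hdeg v (hTS hv)).trans hT.ge)

/-- The vertices `f 0, …, f (n - 1)`, visited in this order, form a closed tour of `G` without
repeated vertices. -/
def IsCyclicTour {V : Type*} (G : SimpleGraph V) (n : ℕ) (f : ℕ → V) : Prop :=
  Set.InjOn f (Set.Iio n) ∧ (∀ i, i + 1 < n → G.Adj (f i) (f (i + 1))) ∧ G.Adj (f (n - 1)) (f 0)

theorem exists_walk_support_eq_map_range {V : Type*} (G : SimpleGraph V) (f : ℕ → V) (i : ℕ)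
    (hf : ∀ j < i, G.Adj (f j) (f (j + 1))) :
    ∃ p : G.Walk (f 0) (f i), p.support = (List.range (i + 1)).map f := by
  induction i with
  | zero => exact ⟨Walk.nil, by simp⟩
  | succ i ih =>
    obtain ⟨p, hp⟩ := ih fun j hj => hf j (by omega)
    refine ⟨p.concat (hf i (by omega)), ?_⟩
    rw [Walk.support_concat, hp, List.range_succ (n := i + 1)]
    simp

theorem IsCyclicTour.isHamiltonian {V : Type*} [Fintype V] [DecidableEq V] {G : SimpleGraph V}
    {f : ℕ → V} (hf : G.IsCyclicTour (Fintype.card V) f) (hV : 3 ≤ Fintype.card V) :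
    G.IsHamiltonian := by
  intro _
  obtain ⟨n, hn⟩ : ∃ n, Fintype.card V = n + 3 := ⟨_, (Nat.sub_add_cancel hV).symm⟩
  obtain ⟨hinj, hadj, hclose⟩ := hf
  rw [hn] at hinj hadj hclose
  obtain ⟨p, hp⟩ := G.exists_walk_support_eq_map_range f (n + 2) fun j hj => hadj j (by omega)
  have hnodup : p.support.Nodup := by
    rw [hp]
    refine List.Nodup.map_on ?_ List.nodup_range
    intro x hx y hy h
    rw [List.mem_range] at hx hy
    exact hinj hx hy h
  have hpath : p.IsPath := (Walk.isPath_def p).2 hnodup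
  have hlen : p.length = n + 2 := by
    have := congrArg List.length hp
    simpa using this
  refine ⟨_, Walk.cons hclose p, ?_⟩
  rw [Walk.isHamiltonianCycle_iff_isCycle_and_length_eq, Walk.cons_isCycle_iff]
  refine ⟨⟨hpath, fun he => ?_⟩, by simp [hlen, hn]⟩
  have := hpath.length_eq_one_of_mem_edges (Sym2.eq_swap ▸ he)
  omega

theorem degree_eq_card_filter_range {V : Type*} [Fintype V] [DecidableEq V] {G : SimpleGraph V}
    [DecidableRel G.Adj] {f : ℕ → V} (hf : Set.InjOn f (Set.Iio (Fintype.card V))) (x : V) :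
    G.degree x = ((Finset.range (Fintype.card V)).filter fun i => G.Adj x (f i)).card := by
  have himg : (Finset.range (Fintype.card V)).image f = Finset.univ := by
    rw [← Finset.card_eq_iff_eq_univ, Finset.card_image_of_injOn, Finset.card_range]
    simpa using hf
  rw [← card_neighborFinset_eq_degree]
  have : G.neighborFinset x =
      ((Finset.range (Fintype.card V)).filter fun i => G.Adj x (f i)).image f := by
    ext w
    have hw : w ∈ (Finset.range (Fintype.card V)).image f := himg ▸ Finset.mem_univ w
    obtain ⟨i, hi, rfl⟩ := Finset.mem_image.1 hw
    rw [mem_neighborFinset, Finset.mem_image]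
    constructor
    · exact fun h => ⟨i, Finset.mem_filter.2 ⟨hi, h⟩, rfl⟩
    · rintro ⟨j, hj, hji⟩
      exact hji ▸ (Finset.mem_filter.1 hj).2
  rw [this, Finset.card_image_of_injOn]
  intro a ha b hb h
  simp only [Finset.coe_filter, Finset.mem_range, Set.mem_ofPred_eq] at ha hb
  exact hf ha.1 hb.1 h

theorem IsCyclicTour.rotate {V : Type*} {G : SimpleGraph V} {n : ℕ} {f : ℕ → V}
    (hf : G.IsCyclicTour n f) {k : ℕ} (hk : k < n) :
    G.IsCyclicTour n fun i => f (if i + k < n then i + k else i + k - n) := by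
  obtain ⟨hinj, hadj, hclose⟩ := hf
  refine ⟨?_, ?_, ?_⟩
  · intro a ha b hb h
    simp only [Set.mem_Iio] at ha hb
    have := hinj (x₁ := if a + k < n then a + k else a + k - n)
      (x₂ := if b + k < n then b + k else b + k - n)
      (by simp only [Set.mem_Iio]; split_ifs <;> omega)
      (by simp only [Set.mem_Iio]; split_ifs <;> omega) h
    split_ifs at this <;> omega
  · intro i hi
    dsimp only
    by_cases h1 : i + 1 + k < n
    · rw [if_pos h1, if_pos (by omega), show i + 1 + k = i + k + 1 by omega]
      exact hadj _ (by omega)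
    · rw [if_neg h1]
      by_cases h2 : i + k < n
      · rw [if_pos h2, show i + k = n - 1 by omega, show i + 1 + k - n = 0 by omega]
        exact hclose
      · rw [if_neg h2, show i + 1 + k - n = i + k - n + 1 by omega]
        exact hadj _ (by omega)
  · dsimp only
    rw [if_pos (show 0 + k < n by omega), zero_add]
    by_cases h : k = 0
    · subst h
      rw [if_pos (by omega)]
      exact hclose
    · rw [if_neg (by omega)]
      have := hadj (k - 1) (by omega)
      rwa [show k - 1 + 1 = k by omega, show k - 1 = n - 1 + k - n by omega] at this

/-- A closed tour obtained from a spanning path by the crossing exchange at position `j`. -/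
theorem exists_isCyclicTour_of_crossing {V : Type*} {G : SimpleGraph V} {n j : ℕ} {f : ℕ → V}
    (hinj : Set.InjOn f (Set.Iio n)) (hadj : ∀ i, i + 1 < n → G.Adj (f i) (f (i + 1)))
    (hj : j + 1 < n) (h0 : G.Adj (f 0) (f (j + 1))) (hlast : G.Adj (f (n - 1)) (f j)) :
    G.IsCyclicTour n fun i => f (if i ≤ j then j - i else i) := by
  refine ⟨?_, ?_, ?_⟩
  · intro a ha b hb h
    simp only [Set.mem_Iio] at ha hb
    have := hinj (x₁ := if a ≤ j then j - a else a) (x₂ := if b ≤ j then j - b else b)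
      (by simp only [Set.mem_Iio]; split_ifs <;> omega)
      (by simp only [Set.mem_Iio]; split_ifs <;> omega) h
    split_ifs at this <;> omega
  · intro i hi
    dsimp only
    rcases lt_trichotomy i j with h | rfl | h
    · rw [if_pos h.le, if_pos (by omega)]
      have := hadj (j - (i + 1)) (by omega)
      rw [show j - (i + 1) + 1 = j - i by omega] at this
      exact this.symm
    · rw [if_pos le_rfl, if_neg (by omega), Nat.sub_self]
      exact h0
    · rw [if_neg (by omega), if_neg (by omega)]
      exact hadj i hi
  · simp only [Nat.zero_le, if_true, Nat.sub_zero]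
    rw [if_neg (by omega)]
    exact hlast

/-- If adding the edge `xy` creates a closed spanning tour, then `deg x + deg y < |V|`, unless
such a tour was there before. -/
theorem degree_add_degree_lt_of_isCyclicTour_sup_edge {V : Type*} [Fintype V] [DecidableEq V]
    {G : SimpleGraph V} [DecidableRel G.Adj] (hV : 3 ≤ Fintype.card V)
    (hG : ∀ f, ¬ G.IsCyclicTour (Fintype.card V) f) {x y : V} {f : ℕ → V}
    (hf : (G ⊔ edge x y).IsCyclicTour (Fintype.card V) f) :
    G.degree x + G.degree y < Fintype.card V := by
  have hor : ∀ u v, (G ⊔ edge x y).Adj u v → ¬ G.Adj u v → (u = x ∧ v = y) ∨ (u = y ∧ v = x) := by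
    intro u v h hn
    rw [sup_adj, edge_adj] at h
    tauto
  obtain ⟨g, hg, hgclose⟩ : ∃ g, (G ⊔ edge x y).IsCyclicTour (Fintype.card V) g ∧
      ¬ G.Adj (g (Fintype.card V - 1)) (g 0) := by
    by_cases hc : G.Adj (f (Fintype.card V - 1)) (f 0)
    · have : ∃ i, i + 1 < Fintype.card V ∧ ¬ G.Adj (f i) (f (i + 1)) := by
        by_contra! h
        exact hG f ⟨hf.1, h, hc⟩
      obtain ⟨i, hi, hni⟩ := this
      refine ⟨_, hf.rotate hi, ?_⟩
      rwa [if_neg (show ¬ Fintype.card V - 1 + (i + 1) < Fintype.card V by omega),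
        if_pos (show 0 + (i + 1) < Fintype.card V by omega), zero_add,
        show Fintype.card V - 1 + (i + 1) - Fintype.card V = i by omega]
    · exact ⟨f, hf, hc⟩
  obtain ⟨hinj, hadj, hclose⟩ := hg
  have hxy := hor _ _ hclose hgclose
  have hpath : ∀ i, i + 1 < Fintype.card V → G.Adj (g i) (g (i + 1)) := by
    intro i hi
    by_contra hni
    have h := hor _ _ (hadj i hi) hni
    have h1 : (g i = g 0 ∧ g (i + 1) = g (Fintype.card V - 1)) ∨
        (g i = g (Fintype.card V - 1) ∧ g (i + 1) = g 0) := by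
      rcases hxy with ⟨h1, h2⟩ | ⟨h1, h2⟩ <;> rw [h1, h2] <;> tauto
    rcases h1 with ⟨h1, h2⟩ | ⟨h1, h2⟩
    · have e1 := hinj (x₁ := i) (x₂ := 0) (Set.mem_Iio.2 (by omega)) (Set.mem_Iio.2 (by omega)) h1
      have e2 := hinj (x₁ := i + 1) (x₂ := Fintype.card V - 1)
        (Set.mem_Iio.2 (by omega)) (Set.mem_Iio.2 (by omega)) h2
      omega
    · have e2 := hinj (x₁ := i + 1) (x₂ := 0) (Set.mem_Iio.2 (by omega)) (Set.mem_Iio.2 (by omega)) h2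
      omega
  have hsum : G.degree x + G.degree y =
      G.degree (g 0) + G.degree (g (Fintype.card V - 1)) := by
    rcases hxy with ⟨h1, h2⟩ | ⟨h1, h2⟩ <;> rw [h1, h2]
    exact add_comm _ _
  obtain ⟨n, hn⟩ : ∃ n, Fintype.card V = n + 1 := ⟨_, (Nat.sub_add_cancel (by omega)).symm⟩
  rw [hsum, degree_eq_card_filter_range hinj, degree_eq_card_filter_range hinj, hn,
    Nat.add_sub_cancel]
  rw [hn, Nat.add_sub_cancel] at hgclose
  set s := (Finset.range n).filter fun i => G.Adj (g 0) (g (i + 1)) with hs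
  set t := (Finset.range n).filter fun i => G.Adj (g n) (g i) with ht
  have h1 : ((Finset.range (n + 1)).filter fun i => G.Adj (g 0) (g i)).card ≤ s.card := by
    rw [← Finset.card_map (addRightEmbedding 1) (s := s)]
    refine Finset.card_le_card fun i hi => ?_
    rw [Finset.mem_filter, Finset.mem_range] at hi
    cases i with
    | zero => exact (G.irrefl hi.2).elim
    | succ i =>
      refine Finset.mem_map.2 ⟨i, ?_, rfl⟩
      simp only [hs, Finset.mem_filter, Finset.mem_range]
      exact ⟨by omega, hi.2⟩
  have h2 : ((Finset.range (n + 1)).filter fun i => G.Adj (g n) (g i)).card ≤ t.card := by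
    refine Finset.card_le_card fun i hi => ?_
    simp only [ht, Finset.mem_filter, Finset.mem_range] at hi ⊢
    refine ⟨lt_of_le_of_ne (by omega) ?_, hi.2⟩
    rintro rfl
    exact G.irrefl hi.2
  have hdisj : Disjoint s t := by
    rw [Finset.disjoint_left]
    intro i his hit
    simp only [hs, ht, Finset.mem_filter, Finset.mem_range] at his hit
    refine hG _ (exists_isCyclicTour_of_crossing hinj hpath (j := i) (by omega) his.2 ?_)
    rw [hn, Nat.add_sub_cancel]
    exact hit.2
  have h3 : (s ∪ t).card ≤ n := by
    simpa using Finset.card_le_card (show s ∪ t ⊆ Finset.range n from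
      Finset.union_subset (Finset.filter_subset _ _) (Finset.filter_subset _ _))
  rw [Finset.card_union_of_disjoint hdisj] at h3
  omega

end SimpleGraph

/-- The permutation of `ℕ` reversing the interval `[a, b]`. -/
def Nat.reverseIcc (a b : ℕ) : Equiv.Perm ℕ :=
  Function.Involutive.toPerm (fun i => if a ≤ i ∧ i ≤ b then a + b - i else i) <| by
    intro i
    dsimp only
    split_ifs <;> omega

theorem Nat.reverseIcc_apply (a b i : ℕ) :
    Nat.reverseIcc a b i = if a ≤ i ∧ i ≤ b then a + b - i else i := rfl

namespace SimpleGraph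

/-- Reversing a segment of an arrangement along a crossing whose removed pairs include a
non-adjacent one decreases the number of non-adjacent consecutive pairs. -/
theorem card_filter_not_adj_reverseIcc_lt {R : SimpleGraph ℕ} [DecidableRel R.Adj] {m p q : ℕ}
    {σ : Equiv.Perm ℕ} (hpq : p < q) (hq : q + 1 < m) (h1 : R.Adj (σ p) (σ q))
    (h2 : R.Adj (σ (p + 1)) (σ (q + 1)))
    (hbreak : ¬ R.Adj (σ p) (σ (p + 1)) ∨ ¬ R.Adj (σ q) (σ (q + 1))) :
    ((Finset.range (m - 1)).filter fun i => ¬ R.Adj (σ (Nat.reverseIcc (p + 1) q i))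
      (σ (Nat.reverseIcc (p + 1) q (i + 1)))).card <
    ((Finset.range (m - 1)).filter fun i => ¬ R.Adj (σ i) (σ (i + 1))).card := by
  set N := (Finset.range (m - 1)).filter fun i => ¬ R.Adj (σ i) (σ (i + 1)) with hN
  have hmap : ∀ i ∈ ((Finset.range (m - 1)).filter fun i =>
      ¬ R.Adj (σ (Nat.reverseIcc (p + 1) q i)) (σ (Nat.reverseIcc (p + 1) q (i + 1)))),
      (if p < i ∧ i < q then p + q - i else i) ∈ N ∧
      (if p < i ∧ i < q then p + q - i else i) ≠ p ∧
      (if p < i ∧ i < q then p + q - i else i) ≠ q := by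
    intro i hi
    rw [Finset.mem_filter, Finset.mem_range, Nat.reverseIcc_apply, Nat.reverseIcc_apply] at hi
    obtain ⟨him, hi⟩ := hi
    by_cases hip : i = p
    · subst hip
      rw [if_neg (by omega), if_pos (by omega), show i + 1 + q - (i + 1) = q by omega] at hi
      exact (hi h1).elim
    by_cases hiq : i = q
    · subst hiq
      rw [if_pos (by omega), if_neg (by omega), show p + 1 + i - i = p + 1 by omega] at hi
      exact (hi h2).elim
    by_cases hin : p < i ∧ i < q
    · rw [if_pos (by omega), if_pos (by omega)] at hi
      rw [if_pos hin, hN, Finset.mem_filter, Finset.mem_range]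
      refine ⟨⟨by omega, fun h => hi ?_⟩, by omega, by omega⟩
      rw [show p + 1 + q - (i + 1) = p + q - i by omega,
        show p + 1 + q - i = p + q - i + 1 by omega]
      exact h.symm
    · rw [if_neg (by omega), if_neg (by omega)] at hi
      rw [if_neg hin, hN, Finset.mem_filter, Finset.mem_range]
      exact ⟨⟨him, hi⟩, hip, hiq⟩
  obtain ⟨z, hzN, hz⟩ : ∃ z ∈ N, z = p ∨ z = q := by
    rcases hbreak with h | h
    · exact ⟨p, Finset.mem_filter.2 ⟨Finset.mem_range.2 (by omega), h⟩, Or.inl rfl⟩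
    · exact ⟨q, Finset.mem_filter.2 ⟨Finset.mem_range.2 (by omega), h⟩, Or.inr rfl⟩
  rw [← Finset.card_erase_add_one hzN, Nat.lt_succ_iff]
  refine Finset.card_le_card_of_injOn (fun i => if p < i ∧ i < q then p + q - i else i) ?_ ?_
  · intro i hi
    obtain ⟨h, hp, hq'⟩ := hmap i hi
    refine Finset.mem_coe.2 (Finset.mem_erase.2 ⟨?_, h⟩)
    rcases hz with rfl | rfl
    · exact hp
    · exact hq'
  · intro a _ b _ h
    dsimp only at h
    split_ifs at h <;> omega

/-- Under the Ore condition with bound `m + 1`, the vertices `0, …, m - 1` have an arrangement as a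
path from `0` to `m - 1`. -/
theorem exists_perm_path_of_ore {R : SimpleGraph ℕ} [DecidableRel R.Adj] {m : ℕ}
    (hR : ∀ i < m, ∀ j < m, i ≠ j → ¬ R.Adj i j →
      m + 1 ≤ ((Finset.range m).filter fun k => R.Adj i k).card +
        ((Finset.range m).filter fun k => R.Adj j k).card) :
    ∃ σ : Equiv.Perm ℕ, σ 0 = 0 ∧ (∀ i, m ≤ i + 1 → σ i = i) ∧
      ∀ i, i + 1 < m → R.Adj (σ i) (σ (i + 1)) := by
  suffices H : ∀ N, ∀ σ : Equiv.Perm ℕ, σ 0 = 0 → (∀ i, m ≤ i + 1 → σ i = i) →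
      ((Finset.range (m - 1)).filter fun i => ¬ R.Adj (σ i) (σ (i + 1))).card = N →
      ∃ σ : Equiv.Perm ℕ, σ 0 = 0 ∧ (∀ i, m ≤ i + 1 → σ i = i) ∧
        ∀ i, i + 1 < m → R.Adj (σ i) (σ (i + 1)) from
    H _ 1 rfl (fun _ _ => rfl) rfl
  intro N
  induction N using Nat.strong_induction_on with
  | _ N ih =>
  intro σ h0 hlast hN
  by_cases hall : ∀ i, i + 1 < m → R.Adj (σ i) (σ (i + 1))
  · exact ⟨σ, h0, hlast, hall⟩
  push Not at hall
  obtain ⟨i, him, hni⟩ := hall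
  have hlt : ∀ j, j < m → σ j < m := by
    intro j hj
    by_contra h
    have h1 := hlast (σ j) (by omega)
    have h2 := σ.injective h1
    omega
  have himg : (Finset.range m).map σ.toEmbedding = Finset.range m := by
    refine Finset.eq_of_subset_of_card_le ?_ (by simp)
    intro j hj
    obtain ⟨k, hk, rfl⟩ := Finset.mem_map.1 hj
    exact Finset.mem_range.2 (hlt k (Finset.mem_range.1 hk))
  have hcount : ∀ x, ((Finset.range m).filter fun k => R.Adj x k).card =
      ((Finset.range m).filter fun k => R.Adj x (σ k)).card := by
    intro x
    conv_lhs => rw [← himg]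
    rw [Finset.filter_map, Finset.card_map]
    rfl
  have hore := hR (σ i) (hlt _ (by omega)) (σ (i + 1)) (hlt _ him)
    (fun h => by have := σ.injective h; omega) hni
  rw [hcount, hcount] at hore
  obtain ⟨n, rfl⟩ : ∃ n, m = n + 1 := ⟨m - 1, by omega⟩
  have e1 : ((Finset.range (n + 1)).filter fun k => R.Adj (σ i) (σ k)).card ≤
      ((Finset.range n).filter fun k => R.Adj (σ i) (σ k)).card + 1 := by
    rw [Finset.range_add_one, Finset.filter_insert]
    split_ifs
    · exact Finset.card_insert_le _ _
    · omega
  have e2 : ((Finset.range (n + 1)).filter fun k => R.Adj (σ (i + 1)) (σ k)).card ≤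
      ((Finset.range n).filter fun k => R.Adj (σ (i + 1)) (σ (k + 1))).card + 1 := by
    rw [← Finset.card_map (addRightEmbedding 1)
      (s := (Finset.range n).filter fun k => R.Adj (σ (i + 1)) (σ (k + 1)))]
    refine (Finset.card_le_card (t := insert 0 _) fun k hk => ?_).trans
      (Finset.card_insert_le 0 _)
    rw [Finset.mem_filter, Finset.mem_range] at hk
    cases k with
    | zero => exact Finset.mem_insert_self _ _
    | succ k =>
      refine Finset.mem_insert_of_mem (Finset.mem_map.2 ⟨k, ?_, rfl⟩)
      exact Finset.mem_filter.2 ⟨Finset.mem_range.2 (by omega), hk.2⟩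
  set s := (Finset.range n).filter fun k => R.Adj (σ i) (σ k) with hs
  set t := (Finset.range n).filter fun k => R.Adj (σ (i + 1)) (σ (k + 1)) with ht
  have hsub : s ∪ t ⊆ (Finset.range n).erase i := by
    intro k hk
    rw [Finset.mem_union, hs, ht, Finset.mem_filter, Finset.mem_filter] at hk
    refine Finset.mem_erase.2 ⟨?_, by tauto⟩
    rintro rfl
    rcases hk with hk | hk <;> exact R.irrefl hk.2
  have hcard := Finset.card_le_card hsub
  rw [Finset.card_erase_of_mem (Finset.mem_range.2 (by omega)), Finset.card_range] at hcard
  have hne : (s ∩ t).Nonempty := by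
    rw [← Finset.card_pos]
    have := Finset.card_union_add_card_inter s t
    omega
  obtain ⟨j, hj⟩ := hne
  rw [Finset.mem_inter, hs, ht, Finset.mem_filter, Finset.mem_filter, Finset.mem_range] at hj
  obtain ⟨⟨hjn, hj1⟩, -, hj2⟩ := hj
  have step : ∀ p q, p < q → q + 1 < n + 1 → R.Adj (σ p) (σ q) → R.Adj (σ (p + 1)) (σ (q + 1)) →
      ¬ R.Adj (σ p) (σ (p + 1)) ∨ ¬ R.Adj (σ q) (σ (q + 1)) →
      ∃ σ : Equiv.Perm ℕ, σ 0 = 0 ∧ (∀ i, n + 1 ≤ i + 1 → σ i = i) ∧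
        ∀ i, i + 1 < n + 1 → R.Adj (σ i) (σ (i + 1)) := by
    intro p q hpq hq h1 h2 hb
    refine ih _ ?_ (σ * Nat.reverseIcc (p + 1) q) ?_ ?_ rfl
    · rw [← hN]
      exact card_filter_not_adj_reverseIcc_lt hpq hq h1 h2 hb
    · rw [Equiv.Perm.mul_apply, Nat.reverseIcc_apply, if_neg (by omega), h0]
    · intro k hk
      rw [Equiv.Perm.mul_apply, Nat.reverseIcc_apply, if_neg (by omega), hlast k hk]
  have hij : i ≠ j := by
    rintro rfl
    exact R.irrefl hj1
  rcases lt_or_gt_of_ne hij with h | h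
  · exact step i j h (by omega) hj1 hj2 (Or.inl hni)
  · exact step j i h him hj1.symm hj2.symm (Or.inr hni)

theorem exists_maximal_not_isCyclicTour {V : Type*} [Fintype V] [DecidableEq V]
    (G : SimpleGraph V) (hV : 3 ≤ Fintype.card V) (hG : ¬ G.IsHamiltonian) :
    ∃ H : SimpleGraph V, G ≤ H ∧ (∀ f, ¬ H.IsCyclicTour (Fintype.card V) f) ∧
      ∀ [DecidableRel H.Adj], ∀ x y, x ≠ y → ¬ H.Adj x y →
        H.degree x + H.degree y < Fintype.card V := by
  obtain ⟨H, hGH, hH⟩ := (Set.toFinite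
    {H : SimpleGraph V | ∀ f, ¬ H.IsCyclicTour (Fintype.card V) f}).exists_le_maximal
    (a := G) (fun f hf => hG (hf.isHamiltonian hV))
  refine ⟨H, hGH, hH.prop, fun x y hxy hadj => ?_⟩
  have : ¬ ∀ f, ¬ (H ⊔ edge x y).IsCyclicTour (Fintype.card V) f := by
    intro h
    refine hadj (hH.le_of_ge h le_sup_left ?_)
    rw [sup_adj, edge_adj]
    tauto
  push Not at this
  obtain ⟨f, hf⟩ := this
  exact degree_add_degree_lt_of_isCyclicTour_sup_edge hV hH.prop hf

theorem exists_not_adj_of_not_isCyclicTour {n : ℕ} (hn : 3 ≤ n) {G : SimpleGraph (Fin n)}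
    (hG : ∀ f, ¬ G.IsCyclicTour n f) : ∃ u v, u ≠ v ∧ ¬ G.Adj u v := by
  by_contra! h
  have hinj : Set.InjOn (fun i => if h : i < n then (⟨i, h⟩ : Fin n) else ⟨0, by omega⟩)
      (Set.Iio n) := by
    intro a ha b hb hab
    rw [Set.mem_Iio] at ha hb
    simpa [ha, hb] using hab
  refine hG _ ⟨hinj, fun i hi => h _ _ fun he => ?_, h _ _ fun he => ?_⟩
  · have := hinj (Set.mem_Iio.2 (by omega)) (Set.mem_Iio.2 hi) he
    omega
  · have := hinj (Set.mem_Iio.2 (by omega)) (Set.mem_Iio.2 (by omega)) he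
    omega

/-- A Pósa-type condition for graphs in which non-adjacent vertices have small degree sum. -/
theorem exists_card_degree_le_of_not_adj {V : Type*} [Fintype V] [DecidableEq V]
    {G : SimpleGraph V} [DecidableRel G.Adj]
    (hsat : ∀ x y, x ≠ y → ¬ G.Adj x y → G.degree x + G.degree y < Fintype.card V)
    {t : ℕ} {x y : V} (hxy : x ≠ y) (hadj : ¬ G.Adj x y) (hx : t ≤ G.degree x)
    (hy : t ≤ G.degree y) :
    ∃ r, t ≤ r ∧ r ≤ (Fintype.card V - 1) / 2 ∧
      ∃ S : Finset V, r ≤ S.card ∧ ∀ v ∈ S, G.degree v ≤ r := by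
  let P : Finset (V × V) := Finset.univ.filter fun p =>
    p.1 ≠ p.2 ∧ ¬ G.Adj p.1 p.2 ∧ t ≤ G.degree p.1 ∧ t ≤ G.degree p.2
  obtain ⟨p, hp, hmax⟩ := P.exists_max_image (fun p => G.degree p.1 + G.degree p.2)
    ⟨(x, y), by simp [P, hxy, hadj, hx, hy]⟩
  simp only [P, Finset.mem_filter, Finset.mem_univ, true_and, Prod.forall] at hp hmax
  obtain ⟨u, v, huv, hnadj, hu, hv, hle, hmax⟩ : ∃ u v, u ≠ v ∧ ¬ G.Adj u v ∧ t ≤ G.degree u ∧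
      t ≤ G.degree v ∧ G.degree u ≤ G.degree v ∧ ∀ a b, a ≠ b ∧ ¬ G.Adj a b ∧
        t ≤ G.degree a ∧ t ≤ G.degree b →
          G.degree a + G.degree b ≤ G.degree u + G.degree v := by
    rcases le_total (G.degree p.1) (G.degree p.2) with h | h
    · exact ⟨p.1, p.2, hp.1, hp.2.1, hp.2.2.1, hp.2.2.2, h, hmax⟩
    · refine ⟨p.2, p.1, hp.1.symm, fun h => hp.2.1 h.symm, hp.2.2.2, hp.2.2.1, h, ?_⟩
      rwa [add_comm (G.degree p.2)]
  have hlt := hsat u v huv hnadj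
  refine ⟨G.degree u, hu, by omega, (insert v (G.neighborFinset v))ᶜ, ?_, ?_⟩
  · rw [Finset.card_compl, Finset.card_insert_of_notMem (by simp), card_neighborFinset_eq_degree]
    omega
  · intro w hw
    rw [Finset.mem_compl, Finset.mem_insert, mem_neighborFinset, not_or] at hw
    by_cases hwt : t ≤ G.degree w
    · have := hmax w v ⟨hw.1, fun h => hw.2 h.symm, hwt, hv⟩
      omega
    · omega

/-- The vertices of degree `d` are exactly `d` in number, and the other vertices form a clique. -/
theorem exists_card_eq_and_isClique_compl {n d k : ℕ} (hn : 3 ≤ n)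
    {G : SimpleGraph (Fin n)} [DecidableRel G.Adj]
    (hδ : ∀ v, d ≤ G.degree v) (hG : ∀ f, ¬ G.IsCyclicTour n f)
    (hsat : ∀ x y, x ≠ y → ¬ G.Adj x y → G.degree x + G.degree y < n)
    (hcliques : (G.cliqueFinset k).card >
      max (hClique n (d + 1) k) (hClique n ((n - 1) / 2) k)) :
    ∃ D : Finset (Fin n), D.card = d ∧ (∀ v, v ∈ D ↔ G.degree v = d) ∧
      ∀ u v, u ∉ D → v ∉ D → u ≠ v → G.Adj u v := by
  have hsat' : ∀ x y, x ≠ y → ¬ G.Adj x y →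
      G.degree x + G.degree y < Fintype.card (Fin n) := by simpa using hsat
  have hno : ∀ r, d < r → r ≤ (n - 1) / 2 → ∀ S : Finset (Fin n), r ≤ S.card →
      ¬ ∀ v ∈ S, G.degree v ≤ r := by
    intro r hr1 hr2 S hS h
    have h1 := G.card_cliqueFinset_le_hClique (k := k) S hS h
    rw [Fintype.card_fin] at h1
    have h2 := hClique_le_max n k (show d + 1 ≤ r from hr1) hr2
    omega
  have hmem : ∀ v, v ∈ (Finset.univ.filter fun v => G.degree v = d) ↔ G.degree v = d := by simp
  refine ⟨Finset.univ.filter fun v => G.degree v = d, le_antisymm ?_ ?_, hmem, ?_⟩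
  · by_contra! h
    have h1 := G.card_cliqueFinset_le_hClique (k := k) (r := d + 1) _ h
      fun v hv => ((hmem v).1 hv).le.trans (Nat.le_succ d)
    rw [Fintype.card_fin] at h1
    omega
  · obtain ⟨u, v, huv, hnadj⟩ := exists_not_adj_of_not_isCyclicTour hn hG
    obtain ⟨r, hr1, hr2, S, hS, hdeg⟩ :=
      exists_card_degree_le_of_not_adj hsat' huv hnadj (hδ u) (hδ v)
    rw [Fintype.card_fin] at hr2
    rcases hr1.eq_or_lt with rfl | hr1
    · exact hS.trans (Finset.card_le_card fun v hv =>
        (hmem v).2 (le_antisymm (hdeg v hv) (hδ v)))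
    · exact (hno r hr1 hr2 S hS hdeg).elim
  · intro u v hu hv huv
    rw [hmem] at hu hv
    by_contra hnadj
    obtain ⟨r, hr1, hr2, S, hS, hdeg⟩ := exists_card_degree_le_of_not_adj (t := d + 1) hsat' huv
      hnadj ((hδ u).lt_of_ne' hu) ((hδ v).lt_of_ne' hv)
    rw [Fintype.card_fin] at hr2
    exact hno r hr1 hr2 S hS hdeg

end SimpleGraph

/-- Vertices can be listed in the order of their colours. -/
theorem Fin.exists_perm_lt_card_iff {n : ℕ} (c : Fin n → ℕ) :
    ∃ e : Equiv.Perm (Fin n), ∀ t i,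
      c (e i) < t ↔ i.val < (Finset.univ.filter fun x => c x < t).card := by
  refine ⟨Tuple.sort c, fun t i => ?_⟩
  have hmono := Tuple.monotone_sort c
  set s := Finset.univ.filter fun j => c (Tuple.sort c j) < t with hs
  have hcard : (Finset.univ.filter fun x => c x < t).card = s.card := by
    rw [← Finset.card_map (Tuple.sort c).toEmbedding (s := s), hs]
    congr 1
    ext x
    simp only [Finset.mem_filter, Finset.mem_univ, true_and, Finset.mem_map]
    constructor
    · intro h
      exact ⟨(Tuple.sort c).symm x, by simpa using h, by simp⟩
    · rintro ⟨a, ha, rfl⟩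
      exact ha
  rw [hcard]
  constructor
  · intro h
    have hsub : Finset.Iic i ⊆ s := by
      intro j hj
      rw [Finset.mem_Iic] at hj
      simp only [hs, Finset.mem_filter, Finset.mem_univ, true_and]
      exact (hmono hj).trans_lt h
    have := Finset.card_le_card hsub
    rw [Fin.card_Iic] at this
    omega
  · intro h
    by_contra hni
    have hsub : s ⊆ Finset.Iio i := by
      intro j hj
      simp only [hs, Finset.mem_filter, Finset.mem_univ, true_and] at hj
      rw [Finset.mem_Iio]
      by_contra hij
      exact hni ((hmono (not_lt.1 hij)).trans_lt hj)
    have := Finset.card_le_card hsub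
    rw [Fin.card_Iio] at this
    omega

/-- Two nested sets can be moved simultaneously to initial segments. -/
theorem Fin.exists_perm_mem_iff_lt_card {n : ℕ} {s t : Finset (Fin n)} (hst : s ⊆ t) :
    ∃ f : Equiv.Perm (Fin n), (∀ x, x ∈ s ↔ (f x).val < s.card) ∧
      ∀ x, x ∈ t ↔ (f x).val < t.card := by
  obtain ⟨e, he⟩ := Fin.exists_perm_lt_card_iff
    (fun x => if x ∈ s then 0 else if x ∈ t then 1 else 2)
  have h1 : (Finset.univ.filter fun x => (if x ∈ s then 0 else if x ∈ t then 1 else 2) < 1) = s := by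
    ext x
    by_cases hs : x ∈ s <;> by_cases ht : x ∈ t <;> simp [hs, ht]
  have h2 : (Finset.univ.filter fun x => (if x ∈ s then 0 else if x ∈ t then 1 else 2) < 2) = t := by
    ext x
    have := @hst x
    by_cases hs : x ∈ s <;> by_cases ht : x ∈ t <;> simp_all
  refine ⟨e.symm, fun x => ?_, fun x => ?_⟩
  · have := he 1 (e.symm x)
    rw [h1, Equiv.apply_symm_apply] at this
    rw [← this]
    by_cases hs : x ∈ s <;> by_cases ht : x ∈ t <;> simp [hs, ht]
  · have := he 2 (e.symm x)
    rw [h2, Equiv.apply_symm_apply] at this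
    rw [← this]
    have := @hst x
    by_cases hs : x ∈ s <;> by_cases ht : x ∈ t <;> simp_all

namespace SimpleGraph

/-- If the vertices outside `D` form a clique and at least two of them are joined to everything
in `D`, then a closed spanning tour exists, provided vertices of `D` have large degree. -/
theorem exists_isCyclicTour_of_isClique_compl {n d : ℕ} {G : SimpleGraph (Fin n)}
    [DecidableRel G.Adj] {B D : Finset (Fin n)} (hBD : Disjoint B D) (hD : D.card = d)
    (hdeg : ∀ v ∈ D, G.degree v = d) (hclique : ∀ u v, u ∉ D → v ∉ D → u ≠ v → G.Adj u v)
    (hB : ∀ x ∈ B, ∀ y ∈ D, G.Adj x y) (hB' : ∀ y ∈ D, ∀ x, G.Adj y x → x ∈ B ∪ D)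
    (h2 : 2 ≤ B.card) (hlt : B.card < d) : ∃ f, G.IsCyclicTour n f := by
  obtain ⟨b₁, hb₁, b₂, hb₂, hb⟩ := Finset.one_lt_card.1 h2
  have hBnD : ∀ x ∈ B, x ∉ D := fun x hx => Finset.disjoint_left.1 hBD hx
  have hm : (B ∪ D).card = B.card + d := by rw [Finset.card_union_of_disjoint hBD, hD]
  have hmn : B.card + d ≤ n := by
    rw [← hm]
    simpa using Finset.card_le_univ (B ∪ D)
  set c : Fin n → ℕ := fun x =>
    if x = b₁ then 0 else if x = b₂ then 2 else if x ∈ B ∪ D then 1 else 3 with hc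
  obtain ⟨e, he⟩ := Fin.exists_perm_lt_card_iff c
  have hc1 : (Finset.univ.filter fun x => c x < 1) = {b₁} := by
    ext x
    simp only [hc, Finset.mem_filter, Finset.mem_univ, true_and, Finset.mem_singleton]
    split_ifs <;> simp_all
  have hc2 : (Finset.univ.filter fun x => c x < 2) = (B ∪ D).erase b₂ := by
    ext x
    have h1 := Finset.mem_union_left D hb₁
    simp only [hc, Finset.mem_filter, Finset.mem_univ, true_and, Finset.mem_erase]
    split_ifs <;> simp_all
  have hc3 : (Finset.univ.filter fun x => c x < 3) = B ∪ D := by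
    ext x
    have h1 := Finset.mem_union_left D hb₁
    have h2 := Finset.mem_union_left D hb₂
    simp only [hc, Finset.mem_filter, Finset.mem_univ, true_and]
    split_ifs <;> simp_all
  set f : ℕ → Fin n := fun i => if h : i < n then e ⟨i, h⟩ else b₁ with hf
  have hinj : Set.InjOn f (Set.Iio n) := by
    intro a ha b hb hab
    rw [Set.mem_Iio] at ha hb
    simpa [hf, ha, hb] using hab
  have hmem : ∀ t i, i < n → (c (f i) < t ↔ i < (Finset.univ.filter fun x => c x < t).card) := by
    intro t i hi
    simp only [hf, dif_pos hi]
    exact he t ⟨i, hi⟩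
  have hBDf : ∀ i < n, (f i ∈ B ∪ D ↔ i < B.card + d) := by
    intro i hi
    rw [← hm, ← hc3, ← hmem 3 i hi]
    simp
  have hf0 : f 0 = b₁ := by
    have := (hmem 1 0 (by omega)).2 (by rw [hc1]; simp)
    rw [← Finset.mem_singleton, ← hc1]
    simpa using this
  have htail : ∀ i < n, B.card + d ≤ i + 1 → f i ∉ D := by
    intro i hi hmi hfD
    have h1 : ¬ c (f i) < 2 := by
      rw [hmem 2 i hi, hc2, Finset.card_erase_of_mem (Finset.mem_union_left D hb₂), hm]
      omega
    have h3 : f i ∉ (B ∪ D).erase b₂ := by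
      rw [← hc2]
      simpa using h1
    exact h3 (Finset.mem_erase.2 ⟨fun h => hBnD b₂ hb₂ (h ▸ hfD), Finset.mem_union_right B hfD⟩)
  have hdegf : ∀ i < B.card + d, f i ∈ D →
      ((Finset.range (B.card + d)).filter fun k => (G.comap f).Adj i k).card = d := by
    intro i hi hfD
    have h1 := degree_eq_card_filter_range (G := G) (f := f) (by rwa [Fintype.card_fin]) (f i)
    rw [hdeg _ hfD, Fintype.card_fin] at h1
    conv_rhs => rw [h1]
    congr 1
    ext k
    simp only [Finset.mem_filter, Finset.mem_range, comap_adj]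
    constructor
    · exact fun h => ⟨by omega, h.2⟩
    · exact fun h => ⟨(hBDf k h.1).1 (hB' _ hfD _ h.2), h.2⟩
  have hne : ∀ i < n, ∀ j < n, i ≠ j → f i ≠ f j := fun i hi j hj hij h => hij (hinj hi hj h)
  have hBadj : ∀ i < B.card + d, ∀ j < B.card + d, i ≠ j → f i ∈ B → G.Adj (f i) (f j) := by
    intro i hi j hj hij hfB
    by_cases hjD : f j ∈ D
    · exact hB _ hfB _ hjD
    · exact hclique _ _ (hBnD _ hfB) hjD (hne i (by omega) j (by omega) hij)
  obtain ⟨σ, hσ0, hσlast, hσ⟩ := exists_perm_path_of_ore (R := G.comap f) (m := B.card + d) <| by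
    intro i hi j hj hij hnadj
    rw [comap_adj] at hnadj
    have hiD : f i ∈ D := by
      rcases Finset.mem_union.1 ((hBDf i (by omega)).2 hi) with h | h
      · exact (hnadj (hBadj i hi j hj hij h)).elim
      · exact h
    have hjD : f j ∈ D := by
      rcases Finset.mem_union.1 ((hBDf j (by omega)).2 hj) with h | h
      · exact (hnadj (hBadj j hj i hi hij.symm h).symm).elim
      · exact h
    rw [hdegf i hi hiD, hdegf j hj hjD]
    omega
  have hσn : ∀ i < n, σ i < n := by
    intro i hi
    by_contra h
    have := σ.injective (hσlast (σ i) (by omega))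
    omega
  refine ⟨fun i => f (σ i), ?_, ?_, ?_⟩
  · intro a ha b hb hab
    exact σ.injective (hinj (hσn a ha) (hσn b hb) hab)
  · intro i hi
    by_cases him : i + 1 < B.card + d
    · exact hσ i him
    · dsimp only
      rw [hσlast i (by omega), hσlast (i + 1) (by omega)]
      exact hclique _ _ (htail _ (by omega) (by omega)) (htail _ hi (by omega))
        (hne _ (by omega) _ hi (by omega))
  · dsimp only
    rw [hσ0, hσlast (n - 1) (by omega)]
    refine hclique _ _ (htail _ (by omega) (by omega)) ?_ (hne _ (by omega) _ (by omega) (by omega))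
    rw [hf0]
    exact hBnD b₁ hb₁

end SimpleGraph

theorem exists_embedding_Hnd {n d : ℕ} {G : SimpleGraph (Fin n)}
    {B D : Finset (Fin n)} (hBD : Disjoint B D) (hD : D.card = d) (hB : B.card = d)
    (hB' : ∀ y ∈ D, ∀ x, G.Adj y x → x ∈ B) :
    ∃ f : Fin n ≃ Fin n, ∀ u v, G.Adj u v → (Hnd n d).Adj (f u) (f v) := by
  have hsub : B ⊆ Dᶜ := fun x hx => Finset.mem_compl.2 (Finset.disjoint_left.1 hBD hx)
  obtain ⟨f, hfB, hfD⟩ := Fin.exists_perm_mem_iff_lt_card hsub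
  rw [Finset.card_compl, hD, Fintype.card_fin] at hfD
  rw [hB] at hfB
  refine ⟨f, fun u v huv => ?_⟩
  rw [Hnd, SimpleGraph.fromRel_adj]
  refine ⟨fun h => huv.ne (f.injective h), ?_⟩
  have hu := hfD u
  have hv := hfD v
  rw [Finset.mem_compl] at hu hv
  by_cases huD : u ∈ D
  · have h1 := (hfB v).1 (hB' u huD v huv)
    have h2 : n - d ≤ (f u).val := not_lt.1 fun h => hu.2 h huD
    exact Or.inr (Or.inr ⟨h1, h2⟩)
  · by_cases hvD : v ∈ D
    · have h1 := (hfB u).1 (hB' v hvD u huv.symm)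
      have h2 : n - d ≤ (f v).val := not_lt.1 fun h => hv.2 h hvD
      exact Or.inl (Or.inr ⟨h1, h2⟩)
    · exact Or.inl (Or.inl ⟨hu.1 huD, hv.1 hvD⟩)

theorem exists_embedding_Knd' {n d : ℕ} {G : SimpleGraph (Fin n)}
    {B D : Finset (Fin n)} (hBD : Disjoint B D) (hD : D.card = d) (hB : B.card = 1)
    (hB' : ∀ y ∈ D, ∀ x, G.Adj y x → x ∈ B ∪ D) :
    ∃ f : Fin n ≃ Fin n, ∀ u v, G.Adj u v → (Knd' n d).Adj (f u) (f v) := by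
  have hsub : (B ∪ D)ᶜ ⊆ Dᶜ := Finset.compl_subset_compl.2 Finset.subset_union_right
  obtain ⟨f, hfB, hfD⟩ := Fin.exists_perm_mem_iff_lt_card hsub
  rw [Finset.card_compl, hD, Fintype.card_fin] at hfD
  rw [Finset.card_compl, Finset.card_union_of_disjoint hBD, hB, hD, Fintype.card_fin] at hfB
  refine ⟨f, fun u v huv => ?_⟩
  rw [Knd', SimpleGraph.fromRel_adj]
  refine ⟨fun h => huv.ne (f.injective h), Or.inl ?_⟩
  have hval : ∀ x, x ∈ B ∪ D → n - d - 1 ≤ (f x).val := by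
    intro x hx
    by_contra h
    exact Finset.mem_compl.1 ((hfB x).2 (by omega)) hx
  by_cases huD : u ∈ D
  · exact Or.inr ⟨hval u (Finset.mem_union_right B huD), hval v (hB' u huD v huv)⟩
  · by_cases hvD : v ∈ D
    · exact Or.inr ⟨hval u (hB' v hvD u huv.symm), hval v (Finset.mem_union_right B hvD)⟩
    · exact Or.inl ⟨(hfD u).1 (Finset.mem_compl.2 huD), (hfD v).1 (Finset.mem_compl.2 hvD)⟩

theorem stability_cliques (n d k : ℕ) (hn : 3 ≤ n) (hd1 : 1 ≤ d) (hd2 : d ≤ (n - 1) / 2)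
    (hk : 2 ≤ k) (G : SimpleGraph (Fin n)) [DecidableRel G.Adj]
    (hδ : ∀ v, d ≤ G.degree v) (hG : ¬ G.IsHamiltonian)
    (hcliques : (G.cliqueFinset k).card >
      max (hClique n (d + 1) k) (hClique n ((n - 1) / 2) k)) :
    (∃ f : Fin n ≃ Fin n, ∀ u v, G.Adj u v → (Hnd n d).Adj (f u) (f v)) ∨
    (∃ f : Fin n ≃ Fin n, ∀ u v, G.Adj u v → (Knd' n d).Adj (f u) (f v)) := by
  classical
  obtain ⟨H, hGH, hH, hsat⟩ := G.exists_maximal_not_isCyclicTour (by simpa using hn) hG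
  rw [Fintype.card_fin] at hH hsat
  suffices h : (∃ f : Fin n ≃ Fin n, ∀ u v, H.Adj u v → (Hnd n d).Adj (f u) (f v)) ∨
      (∃ f : Fin n ≃ Fin n, ∀ u v, H.Adj u v → (Knd' n d).Adj (f u) (f v)) from
    h.imp (fun ⟨f, hf⟩ => ⟨f, fun u v huv => hf u v (hGH huv)⟩)
      (fun ⟨f, hf⟩ => ⟨f, fun u v huv => hf u v (hGH huv)⟩)
  obtain ⟨D, hD, hDdeg, hclique⟩ := SimpleGraph.exists_card_eq_and_isClique_compl (k := k) hn
    (fun v => (hδ v).trans (SimpleGraph.degree_le_of_le hGH)) hH hsat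
    (hcliques.trans_le (Finset.card_le_card (SimpleGraph.cliqueFinset_mono _ hGH)))
  set B := Finset.univ.filter fun x => x ∉ D ∧ ∀ y ∈ D, H.Adj x y with hBdef
  have hmemB : ∀ x, x ∈ B ↔ x ∉ D ∧ ∀ y ∈ D, H.Adj x y := by simp [hBdef]
  have hBD : Disjoint B D := Finset.disjoint_left.2 fun x hx => ((hmemB x).1 hx).1
  have hB : ∀ x ∈ B, ∀ y ∈ D, H.Adj x y := fun x hx => ((hmemB x).1 hx).2
  have hB' : ∀ y ∈ D, ∀ x, H.Adj y x → x ∈ B ∪ D := by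
    intro y hy x hyx
    by_cases hx : x ∈ D
    · exact Finset.mem_union_right B hx
    refine Finset.mem_union_left D ((hmemB x).2 ⟨hx, fun z hz => ?_⟩)
    by_contra hxz
    have h1 := hsat x z (fun h => hx (h ▸ hz)) hxz
    rw [(hDdeg z).1 hz] at h1
    have h2 : insert y (Dᶜ.erase x) ⊆ H.neighborFinset x := by
      intro w hw
      rw [SimpleGraph.mem_neighborFinset]
      rcases Finset.mem_insert.1 hw with rfl | hw
      · exact hyx.symm
      · rw [Finset.mem_erase, Finset.mem_compl] at hw
        exact hclique x w hx hw.2 hw.1.symm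
    have h3 := Finset.card_le_card h2
    rw [Finset.card_insert_of_notMem (by simp [hy]), Finset.card_erase_of_mem (by simpa using hx),
      Finset.card_compl, hD, Fintype.card_fin, SimpleGraph.card_neighborFinset_eq_degree] at h3
    omega
  obtain ⟨y, hy⟩ : D.Nonempty := Finset.card_pos.1 (by omega)
  have hydeg := (hDdeg y).1 hy
  rw [← SimpleGraph.card_neighborFinset_eq_degree] at hydeg
  have hBsub : ∀ y ∈ D, B ⊆ H.neighborFinset y := by
    intro y hy x hx
    rw [SimpleGraph.mem_neighborFinset]
    exact (hB x hx y hy).symm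
  have hBle : B.card ≤ d := hydeg ▸ Finset.card_le_card (hBsub y hy)
  have hBpos : 1 ≤ B.card := by
    have h1 : H.neighborFinset y ⊆ B ∪ D.erase y := by
      intro x hx
      rw [SimpleGraph.mem_neighborFinset] at hx
      rcases Finset.mem_union.1 (hB' y hy x hx) with h | h
      · exact Finset.mem_union_left _ h
      · exact Finset.mem_union_right _ (Finset.mem_erase.2 ⟨hx.ne', h⟩)
    have h2 := (Finset.card_le_card h1).trans (Finset.card_union_le _ _)
    rw [hydeg, Finset.card_erase_of_mem hy, hD] at h2
    omega
  by_cases hBd : B.card = d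
  · refine Or.inl (exists_embedding_Hnd hBD hD hBd fun z hz x hzx => ?_)
    have hzdeg := (hDdeg z).1 hz
    rw [← SimpleGraph.card_neighborFinset_eq_degree] at hzdeg
    rw [Finset.eq_of_subset_of_card_le (hBsub z hz) (by omega), SimpleGraph.mem_neighborFinset]
    exact hzx
  by_cases hB1 : B.card = 1
  · exact Or.inr (exists_embedding_Knd' hBD hD hB1 hB')
  obtain ⟨f, hf⟩ := SimpleGraph.exists_isCyclicTour_of_isClique_compl hBD hD
    (fun v hv => (hDdeg v).1 hv) hclique hB hB' (by omega) (by omega)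
  exact (hH f hf).elim
end
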